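/- There exist universal constants C₁, C₂ > 0 such that the following level-i inequality holds. Let (X,Π) be a two-sided γ-local-spectral expander with γ ≤ 2^{−C₁·k}, and let f ∈ C_k be a Boolean ({0,1}-valued), (ε,i)-pseudorandom function. Then the weight of f on its i-th lifted Bottom-Up level is bounded: ⟨f, f_i^↑⟩ ≤ 2^{C₂·i}·ε^{1/3}·E[f]. -/

import Mathlib

open Finset

/-- Functions on faces of a complex on vertex set `Fin n`. -/
abbrev Cf (n : ℕ) := Finset (Fin n) → ℝ

/-- A `d`-dimensional weighted pure simplicial complex on vertex set `Fin n`: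
the downward closure of a `d`-uniform hypergraph `faces d`, together with a
probability distribution on the top faces inducing distributions `w i` on each
level `faces i` via `π_i(x) = (1/(i+1))·Σ_{y ⊃ x} π_{i+1}(y)`. -/
structure WSC (n d : ℕ) where
  faces : ℕ → Finset (Finset (Fin n))
  top_nonempty : (faces d).Nonempty
  card_mem : ∀ i, ∀ s ∈ faces i, s.card = i
  empty_levels : ∀ i, d < i → faces i = ∅
  downward : ∀ i, i < d → ∀ s : Finset (Fin n),
    s ∈ faces i ↔ (s.card = i ∧ ∃ t ∈ faces (i+1), s ⊆ t)
  w : ℕ → Finset (Fin n) → ℝ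
  w_nonneg : ∀ i s, 0 ≤ w i s
  w_pos : ∀ i, ∀ s ∈ faces i, 0 < w i s
  w_zero : ∀ i s, s ∉ faces i → w i s = 0
  w_top_sum : ∑ s ∈ faces d, w d s = 1
  w_rec : ∀ i, i < d → ∀ s ∈ faces i,
    w i s = (1/(i+1 : ℝ)) * ∑ t ∈ (faces (i+1)).filter (fun t => s ⊆ t), w (i+1) t

variable {n d : ℕ}

/-- The up operator `U_k : C_k → C_{k+1}`. -/
noncomputable def Uop (X : WSC n d) (k : ℕ) (f : Cf n) : Cf n := fun τ =>
  (1/(k+1 : ℝ)) * ∑ σ ∈ (X.faces k).filter (fun σ => σ ⊆ τ), f σ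

/-- The down operator `D_{k+1} : C_{k+1} → C_k`. -/
noncomputable def Dop (X : WSC n d) (k : ℕ) (f : Cf n) : Cf n := fun τ =>
  (∑ σ ∈ (X.faces (k+1)).filter (fun σ => τ ⊆ σ), X.w (k+1) σ * f σ) /
  (∑ σ ∈ (X.faces (k+1)).filter (fun σ => τ ⊆ σ), X.w (k+1) σ)

/-- `Uc X i m : C_i → C_{i+m}` is the iterated up operator; `U_i^k = Uc X i (k-i)`. -/
noncomputable def Uc (X : WSC n d) (i : ℕ) : ℕ → Cf n → Cf n
  | 0, f => f
  | m+1, f => Uop X (i+m) (Uc X i m f)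

/-- `Dc X k m : C_k → C_{k-m}` is the iterated down operator; `D_i^k = Dc X k (k-i)`. -/
noncomputable def Dc (X : WSC n d) (k : ℕ) : ℕ → Cf n → Cf n
  | 0, f => f
  | m+1, f => Dop X (k - (m+1)) (Dc X k m f)

/-- Bottom-Up level functions: `g_i = D_i^k f − Σ_{j<i} C(i,j)·U_j^i g_j ∈ C_i`. -/
noncomputable def gLevel (X : WSC n d) (k : ℕ) (f : Cf n) : ℕ → Cf n
  | i => Dc X k (k - i) f - ∑ j ∈ (Finset.range i).attach,
      ((i.choose j.1 : ℝ)) • Uc X j.1 (i - j.1) (gLevel X k f j.1)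
  termination_by i => i
  decreasing_by exact Finset.mem_range.mp j.2

/-- Lifted Bottom-Up level functions: `f_i^↑ = C(k,i)·U_i^k g_i ∈ C_k`. -/
noncomputable def fLevel (X : WSC n d) (k : ℕ) (f : Cf n) (i : ℕ) : Cf n :=
  ((k.choose i : ℝ)) • Uc X i (k - i) (gLevel X k f i)

/-- Inner product at level `i`: `⟨f,g⟩ = E_{τ∼π_i}[f(τ)g(τ)]`. -/
noncomputable def ip (X : WSC n d) (i : ℕ) (f g : Cf n) : ℝ :=
  ∑ τ ∈ X.faces i, X.w i τ * f τ * g τ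

/-- Expectation at level `i`. -/
noncomputable def EE (X : WSC n d) (i : ℕ) (f : Cf n) : ℝ :=
  ∑ τ ∈ X.faces i, X.w i τ * f τ

/-- `L²` norm at level `i`. -/
noncomputable def norm2 (X : WSC n d) (i : ℕ) (f : Cf n) : ℝ := Real.sqrt (ip X i f f)

/-- `L^p` norm at level `i`. -/
noncomputable def normP (X : WSC n d) (i : ℕ) (p : ℝ) (f : Cf n) : ℝ :=
  (∑ τ ∈ X.faces i, X.w i τ * |f τ| ^ p) ^ (1/p)

/-- `L^∞` norm at level `i` : the maximum of `|f|` over `i`-faces. -/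
noncomputable def normInf (X : WSC n d) (i : ℕ) (f : Cf n) : ℝ :=
  ⨆ τ : {σ // σ ∈ X.faces i}, |f τ.1|

/-- `E_{X_τ}[f|_τ]`: the weighted mean of `f ∈ C_k` over `k`-faces containing `τ`. -/
noncomputable def linkMean (X : WSC n d) (k : ℕ) (τ : Finset (Fin n)) (f : Cf n) : ℝ :=
  (∑ ρ ∈ (X.faces k).filter (fun ρ => τ ⊆ ρ), X.w k ρ * f ρ) /
  (∑ ρ ∈ (X.faces k).filter (fun ρ => τ ⊆ ρ), X.w k ρ)

/-- `⟨f|_τ, g|_τ⟩` over the link `X_τ` with its induced distribution, for `f, g ∈ C_k`. -/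
noncomputable def linkIp (X : WSC n d) (k : ℕ) (τ : Finset (Fin n)) (f g : Cf n) : ℝ :=
  (∑ ρ ∈ (X.faces k).filter (fun ρ => τ ⊆ ρ), X.w k ρ * f ρ * g ρ) /
  (∑ ρ ∈ (X.faces k).filter (fun ρ => τ ⊆ ρ), X.w k ρ)

/-- `f ∈ C_k` is `(ε,i)`-pseudorandom: `|E_{X_τ}[f|_τ]| ≤ ε‖f‖_∞` and
`⟨f|_τ,f|_τ⟩ ≤ ε‖f‖_∞²` for every `i`-face `τ`. -/
def Pseudorandom (X : WSC n d) (k : ℕ) (ε : ℝ) (i : ℕ) (f : Cf n) : Prop :=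
  ∀ τ ∈ X.faces i, |linkMean X k τ f| ≤ ε * normInf X k f ∧
    linkIp X k τ f f ≤ ε * (normInf X k f)^2

/-- Boolean ({0,1}-valued) function on `X(k)`. -/
def IsBool (X : WSC n d) (k : ℕ) (f : Cf n) : Prop := ∀ τ ∈ X.faces k, f τ = 0 ∨ f τ = 1

/-- Total influence `I[f] = ⟨f, k(Id − U_{k−1}D_k) f⟩`. -/
noncomputable def influence (X : WSC n d) (k : ℕ) (f : Cf n) : ℝ :=
  (k : ℝ) * (ip X k f f - ip X k f (Uop X (k-1) (Dop X (k-1) f)))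

/-- Variance `Var(f) = E[f²] − E[f]²`. -/
noncomputable def variance (X : WSC n d) (k : ℕ) (f : Cf n) : ℝ :=
  ip X k f f - (EE X k f)^2

/-- The noise operator `T_ρ = Σ_{i=0}^k C(k,i)(1−ρ)^i ρ^{k−i} U_{k−i}^k D_{k−i}^k`. -/
noncomputable def noiseOp (X : WSC n d) (k : ℕ) (ρ : ℝ) (f : Cf n) : Cf n :=
  ∑ i ∈ Finset.range (k+1),
    ((k.choose i : ℝ) * (1-ρ)^i * ρ^(k-i)) • Uc X (k-i) i (Dc X k i f)

/-- Noise stability `Stab_ρ(f) = ⟨f, T_ρ f⟩`. -/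
noncomputable def stab (X : WSC n d) (k : ℕ) (ρ : ℝ) (f : Cf n) : ℝ :=
  ip X k f (noiseOp X k ρ f)

/-- Edge weights of the underlying graph of the link of `s ∈ X(i)`. -/
noncomputable def edgeW (X : WSC n d) (i : ℕ) (s : Finset (Fin n)) (u v : Fin n) : ℝ :=
  if u ≠ v ∧ u ∉ s ∧ v ∉ s ∧ insert u (insert v s) ∈ X.faces (i+2)
  then X.w (i+2) (insert u (insert v s)) else 0

/-- Vertex weights of the underlying graph of the link of `s ∈ X(i)`. -/
noncomputable def vertW (X : WSC n d) (i : ℕ) (s : Finset (Fin n)) (u : Fin n) : ℝ :=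
  ∑ v, edgeW X i s u v

/-- `X` is a two-sided `γ`-local-spectral expander: for every `i ≤ d−2` and every
`s ∈ X(i)` (including `s = ∅`), every nontrivial eigenvalue of the weighted adjacency
operator of the graph `(X_s(1), X_s(2))` has absolute value at most `γ`, expressed via
the quadratic form on functions orthogonal to constants. -/
def IsLSE (X : WSC n d) (γ : ℝ) : Prop :=
  ∀ i, i + 2 ≤ d → ∀ s ∈ X.faces i, ∀ f : Fin n → ℝ,
    (∑ u, vertW X i s u * f u) = 0 →
    |∑ u, ∑ v, edgeW X i s u v * f u * f v| ≤ γ * ∑ u, vertW X i s u * (f u)^2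

/-- The swap walk `S_{j,i} : C_i → C_j`: `(S_{j,i} f)(τ)` is the weighted mean of `f(σ)`
over `i`-faces `σ` disjoint from `τ` with `τ ∪ σ ∈ X(i+j)`. -/
noncomputable def swapW (X : WSC n d) (j i : ℕ) (f : Cf n) : Cf n := fun τ =>
  (∑ σ ∈ (X.faces i).filter (fun σ => Disjoint σ τ ∧ σ ∪ τ ∈ X.faces (i+j)),
      X.w (i+j) (σ ∪ τ) * f σ) /
  (∑ σ ∈ (X.faces i).filter (fun σ => Disjoint σ τ ∧ σ ∪ τ ∈ X.faces (i+j)),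
      X.w (i+j) (σ ∪ τ))

/-- Localized mean: `E_{σ ∼ π_{v,i}}[f(σ)]`, the mean of `f ∈ C_i` over the `i`-faces of
the link `X_v` of `v ∈ X(j)`, with respect to the distribution induced by the link. -/
noncomputable def locMean (X : WSC n d) (i j : ℕ) (v : Finset (Fin n)) (f : Cf n) : ℝ :=
  (∑ σ ∈ (X.faces i).filter (fun σ => Disjoint σ v ∧ σ ∪ v ∈ X.faces (i+j)),
      X.w (i+j) (σ ∪ v) * f σ) /
  (∑ σ ∈ (X.faces i).filter (fun σ => Disjoint σ v ∧ σ ∪ v ∈ X.faces (i+j)),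
      X.w (i+j) (σ ∪ v))

/-- The `m`-faces of the link `X_τ`. -/
noncomputable def lkFaces (X : WSC n d) (τ : Finset (Fin n)) (m : ℕ) : Finset (Finset (Fin n)) :=
  (Finset.univ : Finset (Finset (Fin n))).filter
    (fun σ => Disjoint σ τ ∧ σ ∪ τ ∈ X.faces (τ.card + m))

/-- Inner product at level `m` of the link `X_τ` (with the induced distribution). -/
noncomputable def lkIp (X : WSC n d) (τ : Finset (Fin n)) (m : ℕ) (f g : Cf n) : ℝ :=
  (∑ σ ∈ lkFaces X τ m, X.w (τ.card + m) (σ ∪ τ) * f σ * g σ) /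
  (∑ σ ∈ lkFaces X τ m, X.w (τ.card + m) (σ ∪ τ))

/-- `L²` norm at level `m` of the link `X_τ`. -/
noncomputable def lkNorm2 (X : WSC n d) (τ : Finset (Fin n)) (m : ℕ) (f : Cf n) : ℝ :=
  Real.sqrt (lkIp X τ m f f)

/-- Global mean at level `m` of the link `X_τ` (the stationary operator `U_0^j D_0^m`
of the swap walk on `X_τ` applied to `f`). -/
noncomputable def lkMeanLvl (X : WSC n d) (τ : Finset (Fin n)) (m : ℕ) (f : Cf n) : ℝ :=
  (∑ σ ∈ lkFaces X τ m, X.w (τ.card + m) (σ ∪ τ) * f σ) /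
  (∑ σ ∈ lkFaces X τ m, X.w (τ.card + m) (σ ∪ τ))

/-- The swap walk `S_{j,m}` within the link `X_τ`. -/
noncomputable def lkSwap (X : WSC n d) (τ : Finset (Fin n)) (j m : ℕ) (f : Cf n) : Cf n := fun v =>
  (∑ σ ∈ (lkFaces X τ m).filter (fun σ => Disjoint σ v ∧ σ ∪ v ∈ lkFaces X τ (m+j)),
      X.w (τ.card + m + j) (σ ∪ v ∪ τ) * f σ) /
  (∑ σ ∈ (lkFaces X τ m).filter (fun σ => Disjoint σ v ∧ σ ∪ v ∈ lkFaces X τ (m+j)),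
      X.w (τ.card + m + j) (σ ∪ v ∪ τ))

/-- Restriction `f|_τ(σ) = f(τ ∪ σ)`. -/
def restrictF (τ : Finset (Fin n)) (f : Cf n) : Cf n := fun σ => f (τ ∪ σ)

/-- The Bottom-Up level function of the restriction `f|_υ` computed within the link
`X_υ` (via its explicit form): `g_ℓ^{(υ)}(I) = Σ_{T ⊆ I} (−1)^{|I∖T|}·E_{(X_υ)_T}[f|_υ]`. -/
noncomputable def gLink (X : WSC n d) (k : ℕ) (f : Cf n) (υ : Finset (Fin n)) : Cf n :=
  fun I => ∑ σ ∈ I.powerset, (-1:ℝ)^((I \ σ).card) * linkMean X k (υ ∪ σ) f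

set_option linter.unusedSectionVars false

section FiniteProduct

variable {ι V : Type*} [Fintype ι] [DecidableEq ι] [Fintype V] [DecidableEq V]

/-- The sum of `F` over `ι → V` with weights `μ`. -/
noncomputable def wsum (μ : (ι → V) → ℝ) : ((ι → V) → ℝ) →ₗ[ℝ] ℝ where
  toFun F := ∑ t, μ t * F t
  map_add' F G := by simp [mul_add, sum_add_distrib]
  map_smul' c F := by
    simp only [Pi.smul_apply, smul_eq_mul, mul_sum, RingHom.id_apply]
    exact sum_congr rfl fun t _ => by ring

lemma wsum_apply (μ F : (ι → V) → ℝ) : wsum μ F = ∑ t, μ t * F t := rfl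

/-- Conditional expectation of `F` given the coordinates in `S`, for the weights `μ`
(zero on fibres of zero mass). -/
noncomputable def condE (μ : (ι → V) → ℝ) (S : Finset ι) :
    ((ι → V) → ℝ) →ₗ[ℝ] ((ι → V) → ℝ) where
  toFun F := fun t => (∑ u with ∀ i ∈ S, u i = t i, μ u * F u) /
    ∑ u with ∀ i ∈ S, u i = t i, μ u
  map_add' F G := by
    ext t
    simp [mul_add, sum_add_distrib, add_div]
  map_smul' c F := by
    ext t
    simp only [Pi.smul_apply, smul_eq_mul, RingHom.id_apply, ← mul_div_assoc, mul_sum]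
    congr 1
    exact sum_congr rfl fun t _ => by ring

lemma condE_apply (μ : (ι → V) → ℝ) (S : Finset ι) (F : (ι → V) → ℝ) (t : ι → V) :
    condE μ S F t = (∑ u with ∀ i ∈ S, u i = t i, μ u * F u) /
      ∑ u with ∀ i ∈ S, u i = t i, μ u := rfl

/-- The seminorm of `L²(μ)`. -/
noncomputable def wnorm (μ F : (ι → V) → ℝ) : ℝ := √(wsum μ (F * F))

variable {μ : (ι → V) → ℝ}

lemma fibre_congr {S : Finset ι} {t u : ι → V} (h : ∀ i ∈ S, t i = u i) :
    (univ.filter fun r : ι → V => ∀ i ∈ S, r i = t i) =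
      univ.filter fun r : ι → V => ∀ i ∈ S, r i = u i := by
  ext r
  simp only [mem_filter, mem_univ, true_and]
  exact forall₂_congr fun i hi => by rw [h i hi]

lemma dependsOn_condE (μ : (ι → V) → ℝ) (S : Finset ι) (F : (ι → V) → ℝ) :
    DependsOn (condE μ S F) (S : Set ι) := by
  intro t u h
  simp only [condE_apply, fibre_congr (S := S) (t := t) (u := u) (by simpa using h)]

lemma DependsOn.mono_finset {F : (ι → V) → ℝ} {S T : Finset ι} (h : DependsOn F (S : Set ι))
    (hST : S ⊆ T) : DependsOn F (T : Set ι) :=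
  fun _ _ htu => h fun i hi => htu i (hST hi)

lemma dependsOn_mul {F G : (ι → V) → ℝ} {S : Set ι} (hF : DependsOn F S) (hG : DependsOn G S) :
    DependsOn (F * G) S := fun t u h => by simp [hF h, hG h]

lemma dependsOn_sub {F G : (ι → V) → ℝ} {S : Set ι} (hF : DependsOn F S) (hG : DependsOn G S) :
    DependsOn (F - G) S := fun t u h => by simp [hF h, hG h]

lemma wsum_nonneg (hμ : 0 ≤ μ) {F : (ι → V) → ℝ} (hF : 0 ≤ F) : 0 ≤ wsum μ F :=
  sum_nonneg fun t _ => mul_nonneg (hμ t) (hF t)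

lemma wsum_mono (hμ : 0 ≤ μ) {F G : (ι → V) → ℝ} (h : F ≤ G) : wsum μ F ≤ wsum μ G :=
  sum_le_sum fun t _ => mul_le_mul_of_nonneg_left (h t) (hμ t)

lemma mass_pos_of_ne (hμ : 0 ≤ μ) (S : Finset ι) {t : ι → V} (ht : μ t ≠ 0) :
    0 < ∑ u with ∀ i ∈ S, u i = t i, μ u :=
  sum_pos' (fun u _ => hμ u) ⟨t, by simp, lt_of_le_of_ne (hμ t) ht.symm⟩

lemma wsum_condE_mul (hμ : 0 ≤ μ) {S : Finset ι} (F : (ι → V) → ℝ) {H : (ι → V) → ℝ}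
    (hH : DependsOn H (S : Set ι)) : wsum μ (condE μ S F * H) = wsum μ (F * H) := by
  simp only [wsum_apply, Pi.mul_apply, condE_apply, sum_div, sum_mul, mul_sum, sum_filter]
  rw [sum_comm]
  refine sum_congr rfl fun u _ => ?_
  by_cases hu : μ u = 0
  · simp [hu]
  have hm := mass_pos_of_ne hμ S hu
  calc _ = ∑ t with ∀ i ∈ S, t i = u i,
        μ t * (μ u * F u * H u / ∑ r with ∀ i ∈ S, r i = u i, μ r) := by
        rw [sum_filter]
        refine sum_congr rfl fun t _ => ?_
        by_cases h : ∀ i ∈ S, t i = u i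
        · have h' : ∀ i ∈ S, u i = t i := fun i hi => (h i hi).symm
          rw [if_pos h, if_pos h', hH (x := t) (y := u) (by simpa using h), ← sum_filter,
            fibre_congr h]
          ring
        · have h' : ¬ ∀ i ∈ S, u i = t i := fun h' => h fun i hi => (h' i hi).symm
          rw [if_neg h, if_neg h']
          simp
    _ = _ := by
        rw [← sum_mul]
        field_simp

lemma condE_mul_of_dependsOn {S : Finset ι} {φ : (ι → V) → ℝ} (hφ : DependsOn φ (S : Set ι))
    (F : (ι → V) → ℝ) : condE μ S (φ * F) = φ * condE μ S F := by
  ext t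
  simp only [condE_apply, Pi.mul_apply, ← mul_div_assoc, mul_sum]
  congr 1
  refine sum_congr rfl fun u hu => ?_
  rw [hφ (x := u) (y := t) (by simpa using hu)]
  ring

lemma condE_condE (hμ : 0 ≤ μ) {S T : Finset ι} (hST : S ⊆ T) (F : (ι → V) → ℝ) :
    condE μ S (condE μ T F) = condE μ S F := by
  ext t
  simp only [condE_apply μ S]
  congr 1
  have key := wsum_condE_mul (μ := μ) hμ (S := T) F
    (H := fun u => if ∀ i ∈ S, u i = t i then 1 else 0) (by
      intro u r h
      have : (∀ i ∈ S, u i = t i) ↔ ∀ i ∈ S, r i = t i :=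
        forall₂_congr fun i hi => by rw [h i (by simpa using hST hi)]
      simp [this])
  simpa [wsum_apply, sum_filter] using key

lemma condE_le (hμ : 0 ≤ μ) (S : Finset ι) {F : (ι → V) → ℝ} {c : ℝ} (hc : 0 ≤ c)
    (hF : ∀ t, F t ≤ c) (t : ι → V) : condE μ S F t ≤ c := by
  rw [condE_apply]
  refine div_le_of_le_mul₀ (sum_nonneg fun u _ => hμ u) hc ?_
  rw [mul_sum]
  exact sum_le_sum fun u _ => by
    rw [mul_comm c]
    exact mul_le_mul_of_nonneg_left (hF u) (hμ u)

lemma condE_nonneg (hμ : 0 ≤ μ) (S : Finset ι) {F : (ι → V) → ℝ} (hF : 0 ≤ F) :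
    0 ≤ condE μ S F := fun _ =>
  div_nonneg (sum_nonneg fun u _ => mul_nonneg (hμ u) (hF u)) (sum_nonneg fun u _ => hμ u)

lemma wsum_mul_self_nonneg (hμ : 0 ≤ μ) (F : (ι → V) → ℝ) : 0 ≤ wsum μ (F * F) :=
  wsum_nonneg hμ fun t => mul_self_nonneg (F t)

lemma wnorm_nonneg (μ F : (ι → V) → ℝ) : 0 ≤ wnorm μ F := Real.sqrt_nonneg _

lemma wnorm_mul_self (hμ : 0 ≤ μ) (F : (ι → V) → ℝ) :
    wnorm μ F * wnorm μ F = wsum μ (F * F) := Real.mul_self_sqrt (wsum_mul_self_nonneg hμ F)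

lemma abs_wsum_mul_le (hμ : 0 ≤ μ) (F G : (ι → V) → ℝ) :
    |wsum μ (F * G)| ≤ wnorm μ F * wnorm μ G := by
  refine abs_le_of_sq_le_sq ?_ (mul_nonneg (wnorm_nonneg _ _) (wnorm_nonneg _ _))
  have h := sum_mul_sq_le_sq_mul_sq univ (fun t => √(μ t) * F t) fun t => √(μ t) * G t
  have e (A B : (ι → V) → ℝ) :
      ∑ t, (√(μ t) * A t) * (√(μ t) * B t) = wsum μ (A * B) :=
    sum_congr rfl fun t _ => by
      calc _ = (√(μ t) * √(μ t)) * (A t * B t) := by ring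
        _ = _ := by rw [Real.mul_self_sqrt (hμ t)]; rfl
  simp only [sq] at h
  rw [e, e, e] at h
  calc wsum μ (F * G) ^ 2 ≤ wsum μ (F * F) * wsum μ (G * G) := by rw [sq]; exact h
    _ = _ := by rw [← wnorm_mul_self hμ, ← wnorm_mul_self hμ]; ring

lemma wnorm_le_of_sq_le (hμ : 0 ≤ μ) {F G : (ι → V) → ℝ} {c : ℝ} (hc : 0 ≤ c)
    (h : wsum μ (F * F) ≤ c * c * wsum μ (G * G)) : wnorm μ F ≤ c * wnorm μ G := by
  refine abs_le_of_sq_le_sq' ?_ (mul_nonneg hc (wnorm_nonneg _ _)) |>.2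
  rw [sq, sq, wnorm_mul_self hμ, mul_mul_mul_comm, wnorm_mul_self hμ]
  exact h

lemma wnorm_mul_le (hμ : 0 ≤ μ) {F : (ι → V) → ℝ} {c : ℝ} (hc : 0 ≤ c) (hF : ∀ t, |F t| ≤ c)
    (G : (ι → V) → ℝ) : wnorm μ (F * G) ≤ c * wnorm μ G := by
  refine wnorm_le_of_sq_le hμ hc ?_
  rw [← smul_eq_mul (c * c), ← map_smul]
  refine wsum_mono hμ fun t => ?_
  simp only [Pi.mul_apply, Pi.smul_apply, smul_eq_mul]
  have : F t * F t ≤ c * c := by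
    rw [← abs_mul_abs_self (F t)]
    exact mul_le_mul (hF t) (hF t) (abs_nonneg _) hc
  nlinarith [mul_self_nonneg (G t)]

lemma wsum_condE_sq_add (hμ : 0 ≤ μ) (S : Finset ι) (F : (ι → V) → ℝ) :
    wsum μ (condE μ S F * condE μ S F) +
      wsum μ ((F - condE μ S F) * (F - condE μ S F)) = wsum μ (F * F) := by
  have h := wsum_condE_mul hμ F (dependsOn_condE μ S F)
  have e : (F - condE μ S F) * (F - condE μ S F) =
      F * F - (2 : ℝ) • (F * condE μ S F) + condE μ S F * condE μ S F := by
    ext t; simp; ring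
  rw [e, map_add, map_sub, map_smul, ← h, smul_eq_mul]
  ring

lemma wnorm_condE_le (hμ : 0 ≤ μ) (S : Finset ι) (F : (ι → V) → ℝ) :
    wnorm μ (condE μ S F) ≤ wnorm μ F := Real.sqrt_le_sqrt <| by
  linarith [wsum_condE_sq_add hμ S F, wsum_mul_self_nonneg hμ (F - condE μ S F)]

lemma wnorm_sub_condE_le (hμ : 0 ≤ μ) (S : Finset ι) (F : (ι → V) → ℝ) :
    wnorm μ (F - condE μ S F) ≤ wnorm μ F := Real.sqrt_le_sqrt <| by
  linarith [wsum_condE_sq_add hμ S F, wsum_mul_self_nonneg hμ (condE μ S F)]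

/-- Functions of disjoint blocks `A`, `B` of coordinates have covariance at most `c` times the
product of their norms, conditionally on the coordinates in `C`. -/
def CovLE (μ : (ι → V) → ℝ) (C A B : Finset ι) (c : ℝ) : Prop :=
  ∀ K H : (ι → V) → ℝ, DependsOn K ((C ∪ A : Finset ι) : Set ι) →
    DependsOn H ((C ∪ B : Finset ι) : Set ι) →
    |wsum μ (K * H) - wsum μ (condE μ C K * condE μ C H)| ≤ c * (wnorm μ K * wnorm μ H)

lemma CovLE.symm {C A B : Finset ι} {c : ℝ} (h : CovLE μ C A B c) : CovLE μ C B A c :=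
  fun K H hK hH => by
    rw [mul_comm K, mul_comm (condE μ C K), mul_comm (wnorm μ K)]
    exact h H K hH hK

lemma CovLE.of_singletons (hμ : 0 ≤ μ) {B : Finset ι} {c : ℝ} (hc : 0 ≤ c)
    (h : ∀ C : Finset ι, ∀ x, Disjoint C B → x ∉ C → x ∉ B → CovLE μ C {x} B c)
    (A : Finset ι) : ∀ C : Finset ι, Disjoint C A → Disjoint C B → Disjoint A B →
      CovLE μ C A B (A.card * c) := by
  induction A using Finset.induction_on with
  | empty =>
    intro C _ hCB _ K H hK hH
    rw [union_empty] at hK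
    rw [wsum_condE_mul hμ K (dependsOn_condE μ C H), mul_comm K (condE μ C H),
      wsum_condE_mul hμ H hK, mul_comm H]
    simp
  | insert x A hx ih =>
    intro C hCA hCB hAB K H hK hH
    rw [disjoint_insert_right] at hCA
    rw [disjoint_insert_left] at hAB
    have h₁ := ih C hCA.2 hCB hAB.2 (condE μ (C ∪ A) K) H (dependsOn_condE μ _ K) hH
    rw [condE_condE hμ subset_union_left] at h₁
    have h₂ := h (C ∪ A) x (disjoint_union_left.2 ⟨hCB, hAB.2⟩) (by simp [hCA.1, hx]) hAB.1
      (K - condE μ (C ∪ A) K) H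
      (dependsOn_sub (hK.mono_finset fun y hy => by simp at hy ⊢; tauto)
        ((dependsOn_condE μ _ K).mono_finset subset_union_left))
      (hH.mono_finset (union_subset_union_left subset_union_left))
    rw [map_sub, condE_condE hμ Subset.rfl, sub_self, zero_mul, map_zero, sub_zero, sub_mul,
      map_sub] at h₂
    have h₃ := wnorm_condE_le hμ (C ∪ A) K
    have h₄ := wnorm_sub_condE_le hμ (C ∪ A) K
    rw [card_insert_of_notMem hx]
    push_cast
    calc _ = |(wsum μ (condE μ (C ∪ A) K * H) - wsum μ (condE μ C K * condE μ C H)) +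
          (wsum μ (K * H) - wsum μ (condE μ (C ∪ A) K * H))| := by congr 1; ring
      _ ≤ _ := abs_add_le _ _
      _ ≤ A.card * c * (wnorm μ K * wnorm μ H) + c * (wnorm μ K * wnorm μ H) := by
        refine add_le_add (h₁.trans ?_) (h₂.trans ?_)
        · exact mul_le_mul_of_nonneg_left (mul_le_mul_of_nonneg_right h₃ (wnorm_nonneg _ _))
            (by positivity)
        · exact mul_le_mul_of_nonneg_left (mul_le_mul_of_nonneg_right h₄ (wnorm_nonneg _ _)) hc
      _ = _ := by ring

/-- Any two distinct coordinates are `γ`-nearly independent, conditionally on any other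
coordinates. -/
def PairwiseCovLE (μ : (ι → V) → ℝ) (γ : ℝ) : Prop :=
  ∀ (C : Finset ι) (x y : ι), x ∉ C → y ∉ C → x ≠ y → CovLE μ C {x} {y} γ

lemma PairwiseCovLE.covLE (hμ : 0 ≤ μ) {γ : ℝ} (hγ : 0 ≤ γ) (h : PairwiseCovLE μ γ)
    {C A B : Finset ι} (hCA : Disjoint C A) (hCB : Disjoint C B) (hAB : Disjoint A B) :
    CovLE μ C A B (A.card * (B.card * γ)) := by
  refine CovLE.of_singletons hμ (by positivity) (fun C x hCB hxC hxB => ?_) A C hCA hCB hAB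
  exact (CovLE.of_singletons hμ hγ
    (fun C y hC hyC hyx => h C y x hyC (by simpa using hC) (by simpa using hyx))
    B C hCB (by simpa using hxC) (by simpa using hxB)).symm

lemma PairwiseCovLE.abs_sub_le (hμ : 0 ≤ μ) {γ : ℝ} (hγ : 0 ≤ γ) (h : PairwiseCovLE μ γ)
    {A B : Finset ι} {K H : (ι → V) → ℝ} (hK : DependsOn K (A : Set ι))
    (hH : DependsOn H (B : Set ι)) :
    |wsum μ (K * H) - wsum μ (condE μ (A ∩ B) K * condE μ (A ∩ B) H)| ≤
      4 ^ Fintype.card ι * γ * (wnorm μ K * wnorm μ H) := by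
  refine (h.covLE hμ hγ (C := A ∩ B) (A := A \ B) (B := B \ A) ?_ ?_ ?_ K H ?_ ?_).trans ?_
  · exact disjoint_left.2 fun x hx => by simp at hx ⊢; tauto
  · exact disjoint_left.2 fun x hx => by simp at hx ⊢; tauto
  · exact disjoint_left.2 fun x hx => by simp at hx ⊢; tauto
  · exact hK.mono_finset fun x hx => by simp; tauto
  · exact hH.mono_finset fun x hx => by simp; tauto
  · have hle (S : Finset ι) : (S.card : ℝ) ≤ 2 ^ Fintype.card ι := by
      exact_mod_cast (card_le_univ S).trans Nat.lt_two_pow_self.le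
    have h4 : (4 : ℝ) ^ Fintype.card ι = 2 ^ Fintype.card ι * 2 ^ Fintype.card ι := by
      rw [← mul_pow]; norm_num
    rw [h4, mul_assoc (2 ^ _ : ℝ) (2 ^ _) γ]
    have := wnorm_nonneg μ K
    have := wnorm_nonneg μ H
    gcongr
    · exact hle _
    · exact hle _

/-- The component of `F` on the coordinates `P`, relative to the coordinates `T`: the alternating
sum of the conditional expectations of `F` given `T ∪ R`, for `R ⊆ P`. -/
noncomputable def lev (μ : (ι → V) → ℝ) (T P : Finset ι) (F : (ι → V) → ℝ) : (ι → V) → ℝ :=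
  ∑ R ∈ P.powerset, (-1 : ℝ) ^ (P \ R).card • condE μ (T ∪ R) F

lemma dependsOn_sum {α : Type*} {s : Finset α} {F : α → (ι → V) → ℝ} {S : Set ι}
    (h : ∀ a ∈ s, DependsOn (F a) S) : DependsOn (∑ a ∈ s, F a) S := fun t u htu => by
  simp only [Finset.sum_apply]
  exact sum_congr rfl fun a ha => h a ha htu

lemma dependsOn_lev (μ : (ι → V) → ℝ) (T P : Finset ι) (F : (ι → V) → ℝ) :
    DependsOn (lev μ T P F) ((T ∪ P : Finset ι) : Set ι) :=
  dependsOn_sum fun R hR t u htu => by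
    have := (dependsOn_condE μ (T ∪ R) F).mono_finset
      (union_subset_union_right (mem_powerset.1 hR)) htu
    simp [this]

lemma lev_mul_of_dependsOn {T : Finset ι} {φ : (ι → V) → ℝ} (hφ : DependsOn φ (T : Set ι))
    (P : Finset ι) (F : (ι → V) → ℝ) : lev μ T P (φ * F) = φ * lev μ T P F := by
  simp only [lev, mul_sum, mul_smul_comm]
  exact sum_congr rfl fun R _ => by
    rw [condE_mul_of_dependsOn (hφ.mono_finset subset_union_left)]

lemma lev_insert (T : Finset ι) {P : Finset ι} {x : ι} (hx : x ∉ P) (F : (ι → V) → ℝ) :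
    lev μ T (insert x P) F = lev μ (insert x T) P F - lev μ T P F := by
  simp only [lev, sum_powerset_insert hx]
  rw [add_comm, sub_eq_add_neg, ← sum_neg_distrib]
  congr 1
  · refine sum_congr rfl fun R _ => ?_
    rw [insert_sdiff_insert, sdiff_insert_of_notMem hx, union_insert, insert_union]
  · refine sum_congr rfl fun R hR => ?_
    have hxR : x ∉ R := fun h => hx (mem_powerset.1 hR h)
    rw [insert_sdiff_of_notMem _ hxR, card_insert_of_notMem (by simp [hx]), pow_succ]
    simp

lemma lev_union (T : Finset ι) : ∀ (U P : Finset ι) (_ : Disjoint T P) (F : (ι → V) → ℝ),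
    lev μ U (T ∪ P) F = ∑ R ∈ T.powerset, (-1 : ℝ) ^ (T \ R).card • lev μ (U ∪ R) P F := by
  induction T using Finset.induction_on with
  | empty => intro U P _ F; simp
  | insert x T hx ih =>
    intro U P hTP F
    rw [disjoint_insert_left] at hTP
    rw [insert_union, lev_insert U (by simp [hx, hTP.1]), ih _ P hTP.2, ih _ P hTP.2,
      sum_powerset_insert hx, add_comm, sub_eq_add_neg, ← sum_neg_distrib]
    congr 1
    · refine sum_congr rfl fun R _ => ?_
      rw [insert_sdiff_insert, sdiff_insert_of_notMem hx, union_insert, insert_union]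
    · refine sum_congr rfl fun R hR => ?_
      have hxR : x ∉ R := fun h => hx (mem_powerset.1 hR h)
      rw [insert_sdiff_of_notMem _ hxR, card_insert_of_notMem (by simp [hx]), pow_succ]
      simp

lemma abs_neg_one_pow_mul (m : ℕ) (a : ℝ) : |(-1 : ℝ) ^ m * a| = |a| := by
  rw [abs_mul, abs_pow, abs_neg, abs_one, one_pow, one_mul]

lemma abs_lev_le {T P : Finset ι} {F : (ι → V) → ℝ} {c : ℝ}
    (h : ∀ S ⊆ T ∪ P, ∀ t, |condE μ S F t| ≤ c) (t : ι → V) :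
    |lev μ T P F t| ≤ 2 ^ P.card * c := by
  simp only [lev, Finset.sum_apply, Pi.smul_apply, smul_eq_mul]
  refine (abs_sum_le_sum_abs _ _).trans ?_
  calc _ ≤ ∑ R ∈ P.powerset, c := sum_le_sum fun R hR => by
        rw [abs_neg_one_pow_mul]
        exact h _ (union_subset_union_right (mem_powerset.1 hR)) t
    _ = _ := by simp

lemma wsum_lev_mul (T P : Finset ι) (F H : (ι → V) → ℝ) : wsum μ (lev μ T P F * H) =
    ∑ R ∈ P.powerset, (-1 : ℝ) ^ (P \ R).card * wsum μ (condE μ (T ∪ R) F * H) := by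
  simp [lev, sum_mul, map_sum]

lemma two_pow_card_le (P : Finset ι) : (2 : ℝ) ^ P.card ≤ 2 ^ Fintype.card ι :=
  pow_le_pow_right₀ one_le_two (card_le_univ P)

lemma wnorm_lev_le (hμ : 0 ≤ μ) (T P : Finset ι) (F : (ι → V) → ℝ) :
    wnorm μ (lev μ T P F) ≤ 2 ^ Fintype.card ι * wnorm μ F := by
  have h : wnorm μ (lev μ T P F) * wnorm μ (lev μ T P F) ≤
      2 ^ P.card * wnorm μ F * wnorm μ (lev μ T P F) := by
    rw [wnorm_mul_self hμ, wsum_lev_mul]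
    calc _ ≤ ∑ R ∈ P.powerset, wnorm μ F * wnorm μ (lev μ T P F) :=
          sum_le_sum fun R _ => by
            refine (le_abs_self _).trans ?_
            rw [abs_neg_one_pow_mul]
            exact (abs_wsum_mul_le hμ _ _).trans
              (mul_le_mul_of_nonneg_right (wnorm_condE_le hμ _ F) (wnorm_nonneg _ _))
      _ = _ := by simp [mul_assoc]
  have h0 := wnorm_nonneg μ F
  refine le_trans ?_ (mul_le_mul_of_nonneg_right (two_pow_card_le P) h0)
  rcases (wnorm_nonneg μ (lev μ T P F)).eq_or_lt with h1 | h1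
  · rw [← h1]; positivity
  · exact le_of_mul_le_mul_right h h1

variable {γ : ℝ}

lemma PairwiseCovLE.abs_wsum_lev_mul_le (hμ : 0 ≤ μ) (hγ : 0 ≤ γ) (h : PairwiseCovLE μ γ)
    {T P M : Finset ι} {x : ι} (hxP : x ∈ P) (hxM : x ∉ M) (hxT : x ∉ T) (F : (ι → V) → ℝ)
    {H : (ι → V) → ℝ} (hH : DependsOn H (M : Set ι)) :
    |wsum μ (lev μ T P F * H)| ≤ 8 ^ Fintype.card ι * γ * (wnorm μ F * wnorm μ H) := by
  obtain ⟨P, hx, rfl⟩ : ∃ Q, x ∉ Q ∧ P = insert x Q :=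
    ⟨P.erase x, notMem_erase x P, (insert_erase hxP).symm⟩
  have hF := wnorm_nonneg μ F
  have hH' := wnorm_nonneg μ H
  have term (A : Finset ι) (hxA : x ∉ A) :
      |wsum μ (condE μ (insert x A) F * H) - wsum μ (condE μ A F * H)| ≤
        4 ^ Fintype.card ι * γ * (wnorm μ F * wnorm μ H) := by
    set G := condE μ (insert x A) F with hG
    have hGA : condE μ A F = condE μ A G := (condE_condE hμ (subset_insert x A) F).symm
    have key := h.abs_sub_le hμ hγ (A := insert x A) (K := G - condE μ A G) (H := H)
      (dependsOn_sub (dependsOn_condE μ _ F)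
        ((dependsOn_condE μ A G).mono_finset (subset_insert x A))) hH
    have hI : insert x A ∩ M ⊆ A := fun y hy => by
      simp only [mem_inter, mem_insert] at hy
      rcases hy with ⟨rfl | hy, hyM⟩
      · exact absurd hyM hxM
      · exact hy
    rw [map_sub, condE_condE hμ hI, sub_self, zero_mul, map_zero, sub_zero, sub_mul,
      map_sub] at key
    rw [hGA]
    refine key.trans ?_
    have := (wnorm_sub_condE_le hμ A G).trans (wnorm_condE_le hμ _ F)
    gcongr
  rw [lev_insert T hx, sub_mul, map_sub, wsum_lev_mul, wsum_lev_mul, ← sum_sub_distrib]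
  calc _ ≤ ∑ R ∈ P.powerset, 4 ^ Fintype.card ι * γ * (wnorm μ F * wnorm μ H) := by
        refine (abs_sum_le_sum_abs _ _).trans (sum_le_sum fun R hR => ?_)
        rw [← mul_sub, abs_neg_one_pow_mul, insert_union]
        exact term _ (by
          simp only [mem_union, not_or]
          exact ⟨hxT, fun h => hx (mem_powerset.1 hR h)⟩)
    _ = 2 ^ P.card * (4 ^ Fintype.card ι * γ * (wnorm μ F * wnorm μ H)) := by simp
    _ ≤ 2 ^ Fintype.card ι * (4 ^ Fintype.card ι * γ * (wnorm μ F * wnorm μ H)) :=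
        mul_le_mul_of_nonneg_right (two_pow_card_le P) (by positivity)
    _ = _ := by
        rw [show (8 : ℝ) = 2 * 4 by norm_num, mul_pow]
        ring

lemma PairwiseCovLE.abs_wsum_lev_sq_sub_le (hμ : 0 ≤ μ) (hγ : 0 ≤ γ) (h : PairwiseCovLE μ γ)
    {T P : Finset ι} (hTP : Disjoint T P) (F : (ι → V) → ℝ) :
    |wsum μ (lev μ T P F * lev μ T P F) - wsum μ (F * lev μ T P F)| ≤
      16 ^ Fintype.card ι * γ * wsum μ (F * F) := by
  have hF := wnorm_nonneg μ F
  have hmain := wsum_condE_mul hμ F (dependsOn_lev μ T P F)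
  rw [wsum_lev_mul, ← add_sum_erase _ _ (mem_powerset_self P), Finset.sdiff_self, ← hmain]
  simp only [card_empty, pow_zero, one_mul, add_sub_cancel_left]
  calc _ ≤ ∑ R ∈ P.powerset.erase P, 8 ^ Fintype.card ι * γ * (wnorm μ F * wnorm μ F) := by
        refine (abs_sum_le_sum_abs _ _).trans (sum_le_sum fun R hR => ?_)
        obtain ⟨hne, hRP⟩ := mem_erase.1 hR
        obtain ⟨x, hxP, hxR⟩ := exists_of_ssubset ((mem_powerset.1 hRP).ssubset_of_ne hne)
        have hxT : x ∉ T := disjoint_right.1 hTP hxP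
        rw [abs_neg_one_pow_mul, mul_comm]
        refine (h.abs_wsum_lev_mul_le hμ hγ hxP (M := T ∪ R) (by simp [hxT, hxR]) hxT F
          (dependsOn_condE μ _ F)).trans ?_
        have := wnorm_condE_le hμ (T ∪ R) F
        gcongr
    _ ≤ ∑ R ∈ P.powerset, 8 ^ Fintype.card ι * γ * (wnorm μ F * wnorm μ F) :=
        sum_le_sum_of_subset_of_nonneg (erase_subset _ _) fun _ _ _ => by positivity
    _ = 2 ^ P.card * (8 ^ Fintype.card ι * γ * (wnorm μ F * wnorm μ F)) := by simp
    _ ≤ 2 ^ Fintype.card ι * (8 ^ Fintype.card ι * γ * (wnorm μ F * wnorm μ F)) :=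
        mul_le_mul_of_nonneg_right (two_pow_card_le P) (by positivity)
    _ = _ := by
        rw [wnorm_mul_self hμ, show (16 : ℝ) = 2 * 8 by norm_num, mul_pow]
        ring

lemma PairwiseCovLE.abs_wsum_lev_mul_lev_le (hμ : 0 ≤ μ) (hγ : 0 ≤ γ) (h : PairwiseCovLE μ γ)
    {T P Q : Finset ι} (hTP : Disjoint T P) (hPQ : ¬ P ⊆ Q) (F : (ι → V) → ℝ) :
    |wsum μ (lev μ T P F * lev μ T Q F)| ≤ 16 ^ Fintype.card ι * γ * wsum μ (F * F) := by
  obtain ⟨x, hxP, hxQ⟩ := not_subset.1 hPQ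
  have hxT : x ∉ T := disjoint_right.1 hTP hxP
  have hF := wnorm_nonneg μ F
  refine (h.abs_wsum_lev_mul_le hμ hγ hxP (by simp [hxT, hxQ]) hxT F
    (dependsOn_lev μ T Q F)).trans ?_
  calc _ ≤ 8 ^ Fintype.card ι * γ * (wnorm μ F * (2 ^ Fintype.card ι * wnorm μ F)) := by
        have := wnorm_lev_le hμ T Q F
        gcongr
    _ = _ := by
        rw [← wnorm_mul_self hμ, show (16 : ℝ) = 2 * 8 by norm_num, mul_pow]
        ring

/-- Approximate Bessel inequality for the components relative to `T`. -/
lemma PairwiseCovLE.sum_wsum_lev_sq_le (hμ : 0 ≤ μ) (hγ : 0 ≤ γ) (h : PairwiseCovLE μ γ)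
    (hsmall : 64 ^ Fintype.card ι * γ ≤ 1) (T : Finset ι) (F : (ι → V) → ℝ) :
    ∑ P ∈ Tᶜ.powerset, wsum μ (lev μ T P F * lev μ T P F) ≤ 4 * wsum μ (F * F) := by
  set N := wsum μ (F * F) with hN
  have hN0 : 0 ≤ N := wsum_mul_self_nonneg hμ F
  set s := ∑ P ∈ Tᶜ.powerset, wsum μ (lev μ T P F * lev μ T P F) with hs
  set Z := ∑ P ∈ Tᶜ.powerset, lev μ T P F with hZ
  have hdisj {P} (hP : P ∈ Tᶜ.powerset) : Disjoint T P :=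
    disjoint_right.2 fun x hx => by simpa using mem_powerset.1 hP hx
  have hcard : ((Tᶜ.powerset.card : ℕ) : ℝ) ≤ 2 ^ Fintype.card ι := by
    rw [card_powerset]
    push_cast
    exact two_pow_card_le _
  have h64 : (64 : ℝ) ^ Fintype.card ι =
      2 ^ Fintype.card ι * (2 ^ Fintype.card ι * 16 ^ Fintype.card ι) := by
    rw [← mul_pow, ← mul_pow]; norm_num
  have h2 : (1 : ℝ) ≤ 2 ^ Fintype.card ι := one_le_pow₀ one_le_two
  have hsN : 64 ^ Fintype.card ι * γ * N ≤ N := by nlinarith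
  have hZ1 : s ≤ wsum μ (F * Z) + N := by
    have : s - wsum μ (F * Z) ≤ 2 ^ Fintype.card ι * (16 ^ Fintype.card ι * γ * N) := by
      rw [hZ, mul_sum, map_sum, hs, ← sum_sub_distrib]
      calc _ ≤ ∑ P ∈ Tᶜ.powerset, 16 ^ Fintype.card ι * γ * N := sum_le_sum fun P hP =>
            (le_abs_self _).trans (h.abs_wsum_lev_sq_sub_le hμ hγ (hdisj hP) F)
        _ = (Tᶜ.powerset.card : ℕ) * (16 ^ Fintype.card ι * γ * N) := by
            rw [sum_const, nsmul_eq_mul]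
        _ ≤ _ := mul_le_mul_of_nonneg_right hcard (by positivity)
    have h3 : 2 ^ Fintype.card ι * (16 ^ Fintype.card ι * γ * N) ≤
        64 ^ Fintype.card ι * γ * N := by
      rw [h64]
      have : 0 ≤ 2 ^ Fintype.card ι * (16 ^ Fintype.card ι * γ * N) := by positivity
      nlinarith
    linarith
  have hZ2 : wsum μ (Z * Z) ≤ s + N := by
    have e : wsum μ (Z * Z) = ∑ P ∈ Tᶜ.powerset, ∑ Q ∈ Tᶜ.powerset,
        wsum μ (lev μ T P F * lev μ T Q F) := by
      simp only [hZ, sum_mul_sum, map_sum]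
    rw [e]
    calc _ ≤ ∑ P ∈ Tᶜ.powerset, ∑ Q ∈ Tᶜ.powerset,
          ((if P = Q then wsum μ (lev μ T P F * lev μ T P F) else 0) +
            16 ^ Fintype.card ι * γ * N) := by
          refine sum_le_sum fun P hP => sum_le_sum fun Q hQ => ?_
          split_ifs with hPQ
          · subst hPQ
            have : 0 ≤ 16 ^ Fintype.card ι * γ * N := by positivity
            linarith
          · rw [zero_add]
            by_cases hsub : P ⊆ Q
            · rw [mul_comm (lev μ T P F)]
              exact (le_abs_self _).trans (h.abs_wsum_lev_mul_lev_le hμ hγ (hdisj hQ)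
                (fun h' => hPQ (Subset.antisymm hsub h')) F)
            · exact (le_abs_self _).trans (h.abs_wsum_lev_mul_lev_le hμ hγ (hdisj hP) hsub F)
      _ = s + (Tᶜ.powerset.card : ℕ) * ((Tᶜ.powerset.card : ℕ) *
            (16 ^ Fintype.card ι * γ * N)) := by
          simp only [sum_add_distrib, sum_const, nsmul_eq_mul, sum_ite_eq]
          rw [hs]
          congr 1
          exact sum_congr rfl fun P hP => if_pos hP
      _ ≤ s + 2 ^ Fintype.card ι * (2 ^ Fintype.card ι * (16 ^ Fintype.card ι * γ * N)) := by
          gcongr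
      _ = s + 64 ^ Fintype.card ι * γ * N := by rw [h64]; ring
      _ ≤ _ := by linarith
  have hFZ : wsum μ (F * Z) ≤ (N + wsum μ (Z * Z)) / 2 := by
    have h0 := wsum_mul_self_nonneg hμ (F - Z)
    have e : (F - Z) * (F - Z) = F * F + Z * Z - (2 : ℝ) • (F * Z) := by ext t; simp; ring
    rw [e, map_sub, map_add, map_smul, smul_eq_mul, ← hN] at h0
    linarith
  linarith

lemma wsum_mul_sums_le {s : Finset ι} {δ : ℝ} {Y₁ Y₂ Y₃ Y₄ : Finset ι → (ι → V) → ℝ}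
    (h : ∀ A ⊆ s, ∀ B ⊆ s, ∀ C ⊆ s, ∀ D ⊆ s,
      |wsum μ (Y₁ A * Y₂ B * (Y₃ C * Y₄ D))| ≤ δ) :
    wsum μ ((∑ A ∈ s.powerset, Y₁ A) * (∑ A ∈ s.powerset, Y₂ A) *
      ((∑ A ∈ s.powerset, Y₃ A) * ∑ A ∈ s.powerset, Y₄ A)) ≤ 16 ^ s.card * δ := by
  calc _ = ∑ A ∈ s.powerset, ∑ B ∈ s.powerset, ∑ C ∈ s.powerset, ∑ D ∈ s.powerset,
        wsum μ (Y₁ A * Y₂ B * (Y₃ C * Y₄ D)) := by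
        simp only [sum_mul_sum, map_sum]
        exact sum_congr rfl fun A _ => sum_comm
    _ ≤ ∑ A ∈ s.powerset, ∑ B ∈ s.powerset, ∑ C ∈ s.powerset, ∑ D ∈ s.powerset, δ :=
        sum_le_sum fun A hA => sum_le_sum fun B hB => sum_le_sum fun C hC =>
          sum_le_sum fun D hD => (le_abs_self _).trans (h A (mem_powerset.1 hA) B
            (mem_powerset.1 hB) C (mem_powerset.1 hC) D (mem_powerset.1 hD))
    _ = _ := by
        simp only [sum_const, card_powerset, nsmul_eq_mul, Nat.cast_pow, Nat.cast_ofNat]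
        rw [show (16 : ℝ) = 2 * (2 * (2 * 2)) by norm_num, mul_pow, mul_pow, mul_pow]
        ring

/-- Hypercontractivity in combinatorial form: if the mixed moments in which some index occurs
exactly once are negligible, then the mixed fourth moment of two sums is controlled by
products of squares. -/
lemma wsum_sq_mul_sq_le (hμ : 0 ≤ μ) {δ : ℝ} (hδ : 0 ≤ δ) (s : Finset ι) :
    ∀ Y Z : Finset ι → (ι → V) → ℝ,
    (∀ A ⊆ s, ∀ B ⊆ s, ∀ C ⊆ s, ∀ D ⊆ s, ∀ x ∈ s,
      (if x ∈ A then 1 else 0) + (if x ∈ B then 1 else 0) +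
        (if x ∈ C then 1 else 0) + (if x ∈ D then 1 else 0) = 1 →
      |wsum μ (Y A * Y B * (Z C * Z D))| ≤ δ) →
    wsum μ ((∑ A ∈ s.powerset, Y A) * (∑ A ∈ s.powerset, Y A) *
        ((∑ A ∈ s.powerset, Z A) * ∑ A ∈ s.powerset, Z A)) ≤
      ∑ A ∈ s.powerset, ∑ B ∈ s.powerset,
        4 ^ (A.card + B.card) * wsum μ (Y A * Y A * (Z B * Z B)) + 16 ^ s.card * δ := by
  induction s using Finset.induction_on with
  | empty => intro Y Z _; simpa using hδ
  | insert x s hx ih =>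
    intro Y Z h
    have hsub {A : Finset ι} (hA : A ⊆ s) : A ⊆ insert x s := hA.trans (subset_insert _ _)
    have hins {A : Finset ι} (hA : A ⊆ s) : insert x A ⊆ insert x s := insert_subset_insert _ hA
    have hxA {A : Finset ι} (hA : A ⊆ s) : x ∉ A := fun h => hx (hA h)
    have hne {y : ι} (hy : y ∈ s) : y ≠ x := fun h => hx (h ▸ hy)
    have h₁ := ih Y Z fun A hA B hB C hC D hD y hy => h A (hsub hA) B (hsub hB) C (hsub hC)
      D (hsub hD) y (mem_insert_of_mem hy)
    have h₂ := ih Y (fun A => Z (insert x A)) fun A hA B hB C hC D hD y hy hy1 =>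
      h A (hsub hA) B (hsub hB) _ (hins hC) _ (hins hD) y (mem_insert_of_mem hy)
        (by simpa [hne hy] using hy1)
    have h₃ := ih (fun A => Y (insert x A)) Z fun A hA B hB C hC D hD y hy hy1 =>
      h _ (hins hA) _ (hins hB) C (hsub hC) D (hsub hD) y (mem_insert_of_mem hy)
        (by simpa [hne hy] using hy1)
    have h₄ := ih (fun A => Y (insert x A)) (fun A => Z (insert x A))
      fun A hA B hB C hC D hD y hy hy1 =>
      h _ (hins hA) _ (hins hB) _ (hins hC) _ (hins hD) y (mem_insert_of_mem hy)
        (by simpa [hne hy] using hy1)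
    have h₅ := wsum_mul_sums_le (μ := μ) (s := s) (δ := δ) (Y₁ := Y) (Y₂ := Y) (Y₃ := Z)
      (Y₄ := fun A => Z (insert x A)) fun A hA B hB C hC D hD =>
      h A (hsub hA) B (hsub hB) C (hsub hC) _ (hins hD) x (mem_insert_self _ _)
        (by simp [hxA hA, hxA hB, hxA hC])
    have h₆ := wsum_mul_sums_le (μ := μ) (s := s) (δ := δ) (Y₁ := Y)
      (Y₂ := fun A => Y (insert x A)) (Y₃ := Z) (Y₄ := Z) fun A hA B hB C hC D hD =>
      h A (hsub hA) _ (hins hB) C (hsub hC) D (hsub hD) x (mem_insert_self _ _)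
        (by simp [hxA hA, hxA hC, hxA hD])
    have hnn : 0 ≤ ∑ A ∈ s.powerset, ∑ B ∈ s.powerset, 4 ^ (A.card + B.card) *
        wsum μ (Y (insert x A) * Y (insert x A) * (Z (insert x B) * Z (insert x B))) :=
      sum_nonneg fun A _ => sum_nonneg fun B _ => mul_nonneg (by positivity)
        (wsum_nonneg hμ fun t => mul_nonneg (mul_self_nonneg _) (mul_self_nonneg _))
    have hmain : ∑ A ∈ (insert x s).powerset, ∑ B ∈ (insert x s).powerset,
          4 ^ (A.card + B.card) * wsum μ (Y A * Y A * (Z B * Z B)) =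
        ∑ A ∈ s.powerset, ∑ B ∈ s.powerset,
          4 ^ (A.card + B.card) * wsum μ (Y A * Y A * (Z B * Z B)) +
        4 * ∑ A ∈ s.powerset, ∑ B ∈ s.powerset, 4 ^ (A.card + B.card) *
          wsum μ (Y A * Y A * (Z (insert x B) * Z (insert x B))) +
        4 * ∑ A ∈ s.powerset, ∑ B ∈ s.powerset, 4 ^ (A.card + B.card) *
          wsum μ (Y (insert x A) * Y (insert x A) * (Z B * Z B)) +
        16 * ∑ A ∈ s.powerset, ∑ B ∈ s.powerset, 4 ^ (A.card + B.card) *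
          wsum μ (Y (insert x A) * Y (insert x A) * (Z (insert x B) * Z (insert x B))) := by
      simp only [sum_powerset_insert hx, sum_add_distrib, mul_sum, ← add_assoc]
      congr 1
      · congr 1
        · congr 1
          refine sum_congr rfl fun A _ => sum_congr rfl fun B hB => ?_
          rw [card_insert_of_notMem (hxA (mem_powerset.1 hB))]
          ring
        · refine sum_congr rfl fun A hA => sum_congr rfl fun B hB => ?_
          rw [card_insert_of_notMem (hxA (mem_powerset.1 hA))]
          ring
      · refine sum_congr rfl fun A hA => sum_congr rfl fun B hB => ?_
        rw [card_insert_of_notMem (hxA (mem_powerset.1 hA)),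
          card_insert_of_notMem (hxA (mem_powerset.1 hB))]
        ring
    rw [hmain, card_insert_of_notMem hx, sum_powerset_insert hx, sum_powerset_insert hx]
    set a := ∑ A ∈ s.powerset, Y A
    set b := ∑ A ∈ s.powerset, Y (insert x A)
    set a' := ∑ A ∈ s.powerset, Z A
    set b' := ∑ A ∈ s.powerset, Z (insert x A)
    have hpt : (a + b) * (a + b) * ((a' + b') * (a' + b')) ≤
        a * a * (a' * a') + (4 : ℝ) • (a * a * (b' * b')) + (4 : ℝ) • (b * b * (a' * a')) +
          (3 : ℝ) • (b * b * (b' * b')) + (2 : ℝ) • (a * a * (a' * b')) +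
          (2 : ℝ) • (a * b * (a' * a')) := fun t => by
      simp only [Pi.mul_apply, Pi.add_apply, Pi.smul_apply, smul_eq_mul]
      nlinarith [sq_nonneg (a t * b' t - a' t * b t), sq_nonneg (b' t * (a t - b t)),
        sq_nonneg (b t * (a' t - b' t))]
    have hle := wsum_mono hμ hpt
    simp only [map_add, map_smul, smul_eq_mul] at hle
    rw [pow_succ]
    linarith

lemma abs_condE_le_one (hμ : 0 ≤ μ) {f : (ι → V) → ℝ} (hf : 0 ≤ f) (hf1 : f ≤ 1) (S : Finset ι)
    (t : ι → V) : |condE μ S f t| ≤ 1 := by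
  rw [abs_of_nonneg (condE_nonneg hμ S hf t)]
  exact condE_le hμ S zero_le_one (fun t => hf1 t) t

lemma abs_lev_le_two_pow (hμ : 0 ≤ μ) {f : (ι → V) → ℝ} (hf : 0 ≤ f) (hf1 : f ≤ 1)
    (T P : Finset ι) (t : ι → V) : |lev μ T P f t| ≤ 2 ^ Fintype.card ι := by
  refine (abs_lev_le (c := 1) (fun S _ t => abs_condE_le_one hμ hf hf1 S t) t).trans ?_
  rw [mul_one]
  exact two_pow_card_le P

lemma wnorm_lev_mul_le (hμ : 0 ≤ μ) {f : (ι → V) → ℝ} (hf : 0 ≤ f) (hf1 : f ≤ 1)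
    (T P : Finset ι) {G : (ι → V) → ℝ} {c : ℝ} (hG : wnorm μ G ≤ c) :
    wnorm μ (lev μ T P f * G) ≤ 2 ^ Fintype.card ι * c :=
  (wnorm_mul_le hμ (by positivity) (abs_lev_le_two_pow hμ hf hf1 T P) G).trans
    (mul_le_mul_of_nonneg_left hG (by positivity))

/-- Mixed fourth moments of components in which some coordinate occurs exactly once are small. -/
lemma PairwiseCovLE.abs_wsum_lev_quad_le (hμ : 0 ≤ μ) (hγ : 0 ≤ γ) (h : PairwiseCovLE μ γ)
    {f : (ι → V) → ℝ} (hf : 0 ≤ f) (hf1 : f ≤ 1) {A B C D : Finset ι} {x : ι}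
    (hA : x ∈ A) (hB : x ∉ B) (hC : x ∉ C) (hD : x ∉ D) :
    |wsum μ (lev μ ∅ A f * lev μ ∅ B f * (lev μ ∅ C f * lev μ ∅ D f))| ≤
      64 ^ Fintype.card ι * γ * wsum μ (f * f) := by
  have hdep (S : Finset ι) (hS : S ⊆ B ∪ C ∪ D) :
      DependsOn (lev μ ∅ S f) ((B ∪ C ∪ D : Finset ι) : Set ι) :=
    (dependsOn_lev μ ∅ S f).mono_finset (by simpa using hS)
  have hH : DependsOn (lev μ ∅ B f * (lev μ ∅ C f * lev μ ∅ D f))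
      ((B ∪ C ∪ D : Finset ι) : Set ι) :=
    dependsOn_mul (hdep B (by grind)) (dependsOn_mul (hdep C (by grind)) (hdep D (by grind)))
  rw [mul_assoc]
  refine (h.abs_wsum_lev_mul_le hμ hγ hA (by simp [hB, hC, hD]) (by simp) f hH).trans ?_
  have hn := wnorm_lev_mul_le hμ hf hf1 ∅ B
    (wnorm_lev_mul_le hμ hf hf1 ∅ C (wnorm_lev_le hμ ∅ D f))
  have := wnorm_nonneg μ f
  calc _ ≤ 8 ^ Fintype.card ι * γ * (wnorm μ f * (2 ^ Fintype.card ι *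
        (2 ^ Fintype.card ι * (2 ^ Fintype.card ι * wnorm μ f)))) := by gcongr
    _ = _ := by
      rw [← wnorm_mul_self hμ, show (64 : ℝ) = 8 * (2 * (2 * 2)) by norm_num, mul_pow, mul_pow,
        mul_pow]
      ring

lemma sum_ite_card_eq {M : Type*} [AddCommMonoid M] (i : ℕ) (G : Finset ι → M) :
    ∑ A ∈ (univ : Finset ι).powerset, (if A.card = i then G A else 0) =
      ∑ A ∈ powersetCard i univ, G A := by
  rw [← sum_filter, powersetCard_eq_filter]

lemma PairwiseCovLE.wsum_fourth_le (hμ : 0 ≤ μ) (hγ : 0 ≤ γ) (h : PairwiseCovLE μ γ)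
    {f : (ι → V) → ℝ} (hf : 0 ≤ f) (hf1 : f ≤ 1) (i : ℕ) :
    wsum μ ((∑ A ∈ powersetCard i univ, lev μ ∅ A f) * (∑ A ∈ powersetCard i univ, lev μ ∅ A f) *
        ((∑ A ∈ powersetCard i univ, lev μ ∅ A f) * ∑ A ∈ powersetCard i univ, lev μ ∅ A f)) ≤
      16 ^ i * ∑ A ∈ powersetCard i univ, ∑ B ∈ powersetCard i univ,
        wsum μ (lev μ ∅ A f * lev μ ∅ A f * (lev μ ∅ B f * lev μ ∅ B f)) +
      16 ^ Fintype.card ι * (64 ^ Fintype.card ι * γ * wsum μ (f * f)) := by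
  have hN := wsum_mul_self_nonneg hμ f
  have hδ : 0 ≤ 64 ^ Fintype.card ι * γ * wsum μ (f * f) := by positivity
  have key := wsum_sq_mul_sq_le hμ hδ univ
    (fun A => if A.card = i then lev μ ∅ A f else 0)
    (fun A => if A.card = i then lev μ ∅ A f else 0) (by
      intro A _ B _ C _ D _ x _ hx
      by_cases hA : A.card = i
      swap; · simpa [hA] using hδ
      by_cases hB : B.card = i
      swap; · simpa [hB] using hδ
      by_cases hC : C.card = i
      swap; · simpa [hC] using hδ
      by_cases hD : D.card = i
      swap; · simpa [hD] using hδ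
      simp only [hA, hB, hC, hD, if_true]
      by_cases xA : x ∈ A
      · simp only [xA, if_true] at hx
        exact h.abs_wsum_lev_quad_le hμ hγ hf hf1 xA (by grind) (by grind) (by grind)
      by_cases xB : x ∈ B
      · rw [mul_comm (lev μ ∅ A f)]
        exact h.abs_wsum_lev_quad_le hμ hγ hf hf1 xB xA (by grind) (by grind)
      by_cases xC : x ∈ C
      · rw [mul_comm]
        exact h.abs_wsum_lev_quad_le hμ hγ hf hf1 xC (by grind) xA xB
      · rw [mul_comm, mul_comm (lev μ ∅ C f)]
        exact h.abs_wsum_lev_quad_le hμ hγ hf hf1 (by grind) xC xA xB)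
  have hsum : ∑ A ∈ (univ : Finset ι).powerset, ∑ B ∈ (univ : Finset ι).powerset,
      4 ^ (A.card + B.card) * wsum μ
        ((if A.card = i then lev μ ∅ A f else 0) * (if A.card = i then lev μ ∅ A f else 0) *
        ((if B.card = i then lev μ ∅ B f else 0) * if B.card = i then lev μ ∅ B f else 0)) =
      16 ^ i * ∑ A ∈ powersetCard i univ, ∑ B ∈ powersetCard i univ,
        wsum μ (lev μ ∅ A f * lev μ ∅ A f * (lev μ ∅ B f * lev μ ∅ B f)) := by
    rw [← sum_ite_card_eq, mul_sum]
    refine sum_congr rfl fun A _ => ?_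
    split_ifs with hA
    · rw [← sum_ite_card_eq, mul_sum]
      refine sum_congr rfl fun B _ => ?_
      split_ifs with hB
      · rw [hA, hB, ← two_mul, pow_mul]
        norm_num
      · simp
    · simp
  rw [hsum, sum_ite_card_eq, card_univ] at key
  exact key

/-- A sum over all sets of a function of the part outside `B`. -/
lemma sum_powerset_sdiff (B : Finset ι) (G : Finset ι → ℝ) :
    ∑ A ∈ (univ : Finset ι).powerset, G (A \ B) = 2 ^ B.card * ∑ P ∈ Bᶜ.powerset, G P := by
  calc _ = ∑ p ∈ B.powerset ×ˢ Bᶜ.powerset, G p.2 := by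
        refine sum_bij' (fun A _ => (A ∩ B, A \ B)) (fun p _ => p.1 ∪ p.2) ?_ ?_ ?_ ?_ ?_
        · intro A _
          simp only [mem_product, mem_powerset, inter_subset_right, true_and]
          exact fun x hx => by simp at hx ⊢; exact hx.2
        · intro p _; simp
        · intro A _
          ext x; simp; tauto
        · rintro ⟨T, P⟩ hp
          simp only [mem_product, mem_powerset] at hp
          have h1 := hp.1
          have h2 : ∀ x ∈ P, x ∉ B := fun x hx => by simpa using hp.2 hx
          refine Prod.ext ?_ ?_
          · ext x
            simp only [mem_inter, mem_union]
            exact ⟨fun hx => hx.1.resolve_right fun hP => h2 x hP hx.2,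
              fun hx => ⟨Or.inl hx, h1 hx⟩⟩
          · ext x
            simp only [mem_sdiff, mem_union]
            exact ⟨fun hx => hx.1.resolve_left fun hT => hx.2 (h1 hT),
              fun hx => ⟨Or.inr hx, h2 x hx⟩⟩
        · intro A _; rfl
    _ = _ := by rw [sum_product]; simp

lemma PairwiseCovLE.wsum_lev_sq_mul_sq_le (hμ : 0 ≤ μ) (hγ : 0 ≤ γ) (h : PairwiseCovLE μ γ)
    {f : (ι → V) → ℝ} (hf : 0 ≤ f) (hf1 : f ≤ 1) {i : ℕ} {A B : Finset ι} (hB : B.card = i) :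
    wsum μ (lev μ ∅ A f * lev μ ∅ A f * (lev μ ∅ B f * lev μ ∅ B f)) ≤
      2 ^ i * ∑ R ∈ B.powerset, (wsum μ (lev μ R (A \ B) f * lev μ R (A \ B) f *
        condE μ R (lev μ ∅ B f * lev μ ∅ B f)) +
        64 ^ Fintype.card ι * γ * wsum μ (f * f)) := by
  have hN := wsum_mul_self_nonneg hμ f
  have hδ : 0 ≤ 64 ^ Fintype.card ι * γ * wsum μ (f * f) := by positivity
  set Q := lev μ ∅ B f * lev μ ∅ B f with hQ
  have hQ0 : 0 ≤ Q := fun t => mul_self_nonneg _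
  have hterm (R : Finset ι) (hR : R ⊆ B) :
      wsum μ (lev μ R (A \ B) f * lev μ R (A \ B) f * Q) ≤
        wsum μ (lev μ R (A \ B) f * lev μ R (A \ B) f * condE μ R Q) +
        64 ^ Fintype.card ι * γ * wsum μ (f * f) := by
    set L := lev μ R (A \ B) f with hL
    have hdL : DependsOn L ((R ∪ A \ B : Finset ι) : Set ι) := dependsOn_lev μ _ _ f
    have hdB : DependsOn (lev μ ∅ B f) (B : Set ι) := by
      simpa using dependsOn_lev μ ∅ B f
    have key := h.abs_sub_le hμ hγ (dependsOn_mul hdL hdL) (dependsOn_mul hdB hdB)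
    have hI : (R ∪ A \ B) ∩ B = R := by
      ext x
      have := @hR x
      simp only [mem_inter, mem_union, mem_sdiff]
      tauto
    rw [hI, wsum_condE_mul hμ _ (dependsOn_condE μ R _)] at key
    have hn1 := wnorm_lev_mul_le hμ hf hf1 R (A \ B) (wnorm_lev_le hμ R (A \ B) f)
    have hn2 := wnorm_lev_mul_le hμ hf hf1 ∅ B (wnorm_lev_le hμ ∅ B f)
    have h3 : 4 ^ Fintype.card ι * γ * (wnorm μ (L * L) * wnorm μ Q) ≤
        64 ^ Fintype.card ι * γ * wsum μ (f * f) := by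
      have := wnorm_nonneg μ f
      have := wnorm_nonneg μ (L * L)
      have := wnorm_nonneg μ Q
      calc _ ≤ 4 ^ Fintype.card ι * γ *
            ((2 ^ Fintype.card ι * (2 ^ Fintype.card ι * wnorm μ f)) *
              (2 ^ Fintype.card ι * (2 ^ Fintype.card ι * wnorm μ f))) := by gcongr
        _ = _ := by
          rw [← wnorm_mul_self hμ, show (64 : ℝ) = 4 * (2 * (2 * (2 * 2))) by norm_num, mul_pow,
            mul_pow, mul_pow, mul_pow]
          ring
    linarith [(abs_le.1 key).2]
  have hsplit : lev μ ∅ A f = ∑ R ∈ (A ∩ B).powerset,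
      (-1 : ℝ) ^ ((A ∩ B) \ R).card • lev μ R (A \ B) f := by
    have := lev_union (μ := μ) (A ∩ B) ∅ (A \ B)
      (disjoint_left.2 fun x hx => by simp at hx ⊢; tauto) f
    rw [union_comm, sdiff_union_inter] at this
    simpa using this
  have hpt : lev μ ∅ A f * lev μ ∅ A f * Q ≤
      (2 ^ i : ℝ) • ∑ R ∈ B.powerset, lev μ R (A \ B) f * lev μ R (A \ B) f * Q := fun t => by
    have hcs : lev μ ∅ A f t ^ 2 ≤
        2 ^ (A ∩ B).card * ∑ R ∈ (A ∩ B).powerset, lev μ R (A \ B) f t ^ 2 := by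
      have := sq_sum_le_card_mul_sum_sq (s := (A ∩ B).powerset)
        (f := fun R => (-1 : ℝ) ^ ((A ∩ B) \ R).card * lev μ R (A \ B) f t)
      rw [hsplit, Finset.sum_apply]
      simp only [Pi.smul_apply, smul_eq_mul]
      refine this.trans_eq ?_
      rw [card_powerset]
      push_cast
      congr 1
      refine sum_congr rfl fun R _ => ?_
      rw [mul_pow, ← pow_mul, mul_comm _ 2, pow_mul]
      simp
    have hcard : (A ∩ B).card ≤ i := hB ▸ card_le_card inter_subset_right
    simp only [Pi.mul_apply, Pi.smul_apply, Finset.sum_apply, smul_eq_mul, ← sum_mul, ← mul_assoc]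
    refine mul_le_mul_of_nonneg_right ?_ (hQ0 t)
    rw [← sq]
    refine hcs.trans ?_
    simp only [← sq]
    have hsub : ∑ R ∈ (A ∩ B).powerset, lev μ R (A \ B) f t ^ 2 ≤
        ∑ R ∈ B.powerset, lev μ R (A \ B) f t ^ 2 :=
      sum_le_sum_of_subset_of_nonneg (powerset_mono.2 inter_subset_right)
        fun _ _ _ => sq_nonneg _
    have h0 : 0 ≤ ∑ R ∈ (A ∩ B).powerset, lev μ R (A \ B) f t ^ 2 :=
      sum_nonneg fun _ _ => sq_nonneg _
    gcongr
    exact one_le_two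
  refine (wsum_mono hμ hpt).trans ?_
  rw [map_smul, smul_eq_mul, map_sum]
  gcongr with R hR
  exact hterm R (mem_powerset.1 hR)

lemma PairwiseCovLE.sum_wsum_lev_sq_mul_le (hμ : 0 ≤ μ) (hγ : 0 ≤ γ) (h : PairwiseCovLE μ γ)
    (hsmall : 64 ^ Fintype.card ι * γ ≤ 1) {f : (ι → V) → ℝ} (hff : f * f = f) {ε : ℝ}
    {R : Finset ι} (hε : ∀ t, condE μ R f t ≤ ε) {Q : (ι → V) → ℝ} (hQ : 0 ≤ Q) :
    ∑ P ∈ Rᶜ.powerset, wsum μ (lev μ R P f * lev μ R P f * condE μ R Q) ≤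
      4 * (ε * wsum μ Q) := by
  have hφ0 := condE_nonneg hμ R hQ
  set ψ : (ι → V) → ℝ := fun t => √(condE μ R Q t) with hψ
  have hψψ : ψ * ψ = condE μ R Q := funext fun t => Real.mul_self_sqrt (hφ0 t)
  have hdψ : DependsOn ψ (R : Set ι) := fun t u htu => by
    simp only [hψ, dependsOn_condE μ R Q htu]
  have key := h.sum_wsum_lev_sq_le hμ hγ hsmall R (ψ * f)
  have e1 (P : Finset ι) : lev μ R P (ψ * f) * lev μ R P (ψ * f) =
      lev μ R P f * lev μ R P f * condE μ R Q := by
    rw [lev_mul_of_dependsOn hdψ, ← hψψ]; ring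
  have e2 : ψ * f * (ψ * f) = f * condE μ R Q := by
    rw [← hψψ]; nth_rewrite 3 [← hff]; ring
  simp only [e1, e2] at key
  refine key.trans (mul_le_mul_of_nonneg_left ?_ (by norm_num))
  rw [← wsum_condE_mul hμ f (dependsOn_condE μ R Q)]
  have e3 : wsum μ (condE μ R Q) = wsum μ Q := by
    have := wsum_condE_mul hμ (S := R) Q (H := 1) fun _ _ _ => rfl
    simpa using this
  rw [← e3, ← smul_eq_mul ε, ← map_smul]
  exact wsum_mono hμ fun t => mul_le_mul_of_nonneg_right (hε t) (hφ0 t)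

lemma card_powersetCard_univ_le (i : ℕ) :
    ((powersetCard i (univ : Finset ι)).card : ℝ) ≤ 2 ^ Fintype.card ι := by
  rw [card_powersetCard, card_univ]
  exact_mod_cast Nat.choose_le_two_pow _ _

lemma PairwiseCovLE.sum_wsum_lev_sq_mul_sq_le (hμ : 0 ≤ μ) (hγ : 0 ≤ γ) (h : PairwiseCovLE μ γ)
    (hsmall : 64 ^ Fintype.card ι * γ ≤ 1) {f : (ι → V) → ℝ} (hf : 0 ≤ f) (hf1 : f ≤ 1)
    (hff : f * f = f) {ε : ℝ} {i : ℕ} (hε : ∀ S : Finset ι, S.card ≤ i → ∀ t, condE μ S f t ≤ ε)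
    {B : Finset ι} (hB : B.card = i) :
    ∑ A ∈ powersetCard i univ, wsum μ (lev μ ∅ A f * lev μ ∅ A f * (lev μ ∅ B f * lev μ ∅ B f)) ≤
      4 * 8 ^ i * ε * wsum μ (lev μ ∅ B f * lev μ ∅ B f) +
        512 ^ Fintype.card ι * γ * wsum μ f := by
  set Q := lev μ ∅ B f * lev μ ∅ B f with hQ
  have hQ0 : 0 ≤ Q := fun t => mul_self_nonneg _
  have hN : 0 ≤ wsum μ f := wsum_nonneg hμ hf
  set δ := 64 ^ Fintype.card ι * γ * wsum μ f with hδ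
  have hδ0 : 0 ≤ δ := by positivity
  have hik : i ≤ Fintype.card ι := hB ▸ card_le_univ B
  have hR (R : Finset ι) (hR : R ∈ B.powerset) :
      ∑ A ∈ powersetCard i univ, wsum μ (lev μ R (A \ B) f * lev μ R (A \ B) f * condE μ R Q) ≤
        2 ^ i * (4 * (ε * wsum μ Q)) := by
    have hRB := mem_powerset.1 hR
    have hnn (P : Finset ι) : 0 ≤ wsum μ (lev μ R P f * lev μ R P f * condE μ R Q) :=
      wsum_nonneg hμ fun t => mul_nonneg (mul_self_nonneg _) (condE_nonneg hμ R hQ0 t)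
    calc _ ≤ ∑ A ∈ (univ : Finset ι).powerset,
          wsum μ (lev μ R (A \ B) f * lev μ R (A \ B) f * condE μ R Q) :=
          sum_le_sum_of_subset_of_nonneg (fun A _ => by simp) fun A _ _ => hnn _
      _ = 2 ^ i * ∑ P ∈ Bᶜ.powerset, wsum μ (lev μ R P f * lev μ R P f * condE μ R Q) := by
          rw [sum_powerset_sdiff B fun P => wsum μ (lev μ R P f * lev μ R P f * condE μ R Q), hB]
      _ ≤ 2 ^ i * ∑ P ∈ Rᶜ.powerset, wsum μ (lev μ R P f * lev μ R P f * condE μ R Q) := by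
          refine mul_le_mul_of_nonneg_left ?_ (by positivity)
          exact sum_le_sum_of_subset_of_nonneg
            (powerset_mono.2 (compl_subset_compl.2 hRB)) fun A _ _ => hnn _
      _ ≤ _ := by
          refine mul_le_mul_of_nonneg_left ?_ (by positivity)
          exact h.sum_wsum_lev_sq_mul_le hμ hγ hsmall hff
            (hε R ((card_le_card hRB).trans_eq hB)) hQ0
  calc _ ≤ ∑ A ∈ powersetCard i univ, 2 ^ i * ∑ R ∈ B.powerset,
        (wsum μ (lev μ R (A \ B) f * lev μ R (A \ B) f * condE μ R Q) + δ) := by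
        refine sum_le_sum fun A _ => ?_
        have := h.wsum_lev_sq_mul_sq_le hμ hγ hf hf1 (A := A) hB
        rwa [hff] at this
    _ = 2 ^ i * ∑ R ∈ B.powerset, ((∑ A ∈ powersetCard i univ,
        wsum μ (lev μ R (A \ B) f * lev μ R (A \ B) f * condE μ R Q)) +
          (powersetCard i (univ : Finset ι)).card * δ) := by
        rw [← mul_sum, sum_comm]
        simp only [sum_add_distrib, sum_const, nsmul_eq_mul]
    _ ≤ 2 ^ i * ∑ R ∈ B.powerset, (2 ^ i * (4 * (ε * wsum μ Q)) + 2 ^ Fintype.card ι * δ) := by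
        gcongr with R hRB
        · exact hR R hRB
        · exact card_powersetCard_univ_le i
    _ = 4 * (2 * (2 * 2)) ^ i * ε * wsum μ Q + 2 ^ i * (2 ^ i * (2 ^ Fintype.card ι * δ)) := by
        rw [sum_const, card_powerset, hB, nsmul_eq_mul, mul_pow, mul_pow]
        push_cast
        ring
    _ ≤ 4 * (2 * (2 * 2)) ^ i * ε * wsum μ Q +
        2 ^ Fintype.card ι * (2 ^ Fintype.card ι * (2 ^ Fintype.card ι * δ)) := by
        have : (2 : ℝ) ^ i ≤ 2 ^ Fintype.card ι := pow_le_pow_right₀ one_le_two hik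
        gcongr
    _ = _ := by
        rw [hδ, show (512 : ℝ) = 2 * (2 * (2 * 64)) by norm_num, mul_pow 2 (2 * (2 * 64)),
          mul_pow 2 (2 * 64), mul_pow 2 64]
        norm_num
        ring

lemma PairwiseCovLE.sum_wsum_lev_sq_le_weight (hμ : 0 ≤ μ) (hγ : 0 ≤ γ) (h : PairwiseCovLE μ γ)
    {f : (ι → V) → ℝ} (hf : 0 ≤ f) (hff : f * f = f) (i : ℕ) :
    ∑ B ∈ powersetCard i univ, wsum μ (lev μ ∅ B f * lev μ ∅ B f) ≤
      ∑ B ∈ powersetCard i univ, wsum μ (f * lev μ ∅ B f) +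
        32 ^ Fintype.card ι * γ * wsum μ f := by
  have hN : 0 ≤ wsum μ f := wsum_nonneg hμ hf
  calc _ ≤ ∑ B ∈ powersetCard i univ,
        (wsum μ (f * lev μ ∅ B f) + 16 ^ Fintype.card ι * γ * wsum μ f) := by
        refine sum_le_sum fun B _ => ?_
        have := h.abs_wsum_lev_sq_sub_le hμ hγ (disjoint_empty_left B) f
        rw [hff] at this
        linarith [(abs_le.1 this).2]
    _ ≤ _ := by
        rw [sum_add_distrib, sum_const, nsmul_eq_mul, show (32 : ℝ) = 2 * 16 by norm_num, mul_pow,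
          mul_assoc (2 ^ _), mul_assoc (2 ^ _)]
        gcongr
        exact card_powersetCard_univ_le i

lemma PairwiseCovLE.wsum_fourth_le_weight (hμ : 0 ≤ μ) (hγ : 0 ≤ γ) (h : PairwiseCovLE μ γ)
    (hsmall : 64 ^ Fintype.card ι * γ ≤ 1) {f : (ι → V) → ℝ} (hf : 0 ≤ f) (hf1 : f ≤ 1)
    (hff : f * f = f) {ε : ℝ} {i : ℕ} (hε : ∀ S : Finset ι, S.card ≤ i → ∀ t, condE μ S f t ≤ ε)
    (hε0 : 0 ≤ ε) (hε1 : ε ≤ 1) (hi : i ≤ Fintype.card ι) :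
    wsum μ ((∑ A ∈ powersetCard i univ, lev μ ∅ A f) * (∑ A ∈ powersetCard i univ, lev μ ∅ A f) *
        ((∑ A ∈ powersetCard i univ, lev μ ∅ A f) * ∑ A ∈ powersetCard i univ, lev μ ∅ A f)) ≤
      4 * 128 ^ i * ε * ∑ B ∈ powersetCard i univ, wsum μ (f * lev μ ∅ B f) +
        6 * 16384 ^ Fintype.card ι * γ * wsum μ f := by
  have hN : 0 ≤ wsum μ f := wsum_nonneg hμ hf
  have h4 := h.wsum_fourth_le hμ hγ hf hf1 i
  have hs := h.sum_wsum_lev_sq_le_weight hμ hγ hf hff i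
  set W := ∑ B ∈ powersetCard i univ, wsum μ (f * lev μ ∅ B f) with hW
  set s := ∑ B ∈ powersetCard i univ, wsum μ (lev μ ∅ B f * lev μ ∅ B f) with hsdef
  set N := wsum μ f with hNdef
  set k := Fintype.card ι with hk
  rw [hff] at h4
  have hAB : ∑ A ∈ powersetCard i univ, ∑ B ∈ powersetCard i univ,
      wsum μ (lev μ ∅ A f * lev μ ∅ A f * (lev μ ∅ B f * lev μ ∅ B f)) ≤
        4 * 8 ^ i * ε * s + 1024 ^ k * γ * N := by
    rw [sum_comm]
    calc _ ≤ ∑ B ∈ powersetCard i univ,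
          (4 * 8 ^ i * ε * wsum μ (lev μ ∅ B f * lev μ ∅ B f) + 512 ^ k * γ * N) :=
          sum_le_sum fun B hB => h.sum_wsum_lev_sq_mul_sq_le hμ hγ hsmall hf hf1 hff hε
            (mem_powersetCard.1 hB).2
      _ ≤ _ := by
          rw [sum_add_distrib, sum_const, nsmul_eq_mul, ← mul_sum,
            show (1024 : ℝ) = 2 * 512 by norm_num, mul_pow, mul_assoc (2 ^ _), mul_assoc (2 ^ _)]
          gcongr
          exact card_powersetCard_univ_le i
  have p1 : (128 : ℝ) ^ i = 16 ^ i * 8 ^ i := by rw [← mul_pow]; norm_num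
  have p2 : (16384 : ℝ) ^ k = 16 ^ k * 1024 ^ k := by rw [← mul_pow]; norm_num
  have p3 : (1024 : ℝ) ^ k = 16 ^ k * 64 ^ k := by rw [← mul_pow]; norm_num
  have p4 : (128 : ℝ) ^ i * 32 ^ k ≤ 16384 ^ k := by
    calc (128 : ℝ) ^ i * 32 ^ k ≤ 128 ^ k * 32 ^ k := by gcongr; norm_num
      _ = 4096 ^ k := by rw [← mul_pow]; norm_num
      _ ≤ _ := by gcongr; norm_num
  have p5 : (1024 : ℝ) ^ k ≤ 16384 ^ k := by gcongr; norm_num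
  have hγN : 0 ≤ γ * N := mul_nonneg hγ hN
  have q1 : 16 ^ i * (4 * 8 ^ i * ε * s + 1024 ^ k * γ * N) ≤
      4 * 128 ^ i * ε * W + 4 * 16384 ^ k * (γ * N) + 16384 ^ k * (γ * N) := by
    have a1 : 4 * 128 ^ i * ε * s ≤ 4 * 128 ^ i * ε * (W + 32 ^ k * γ * N) := by gcongr
    have a2 : 4 * (128 ^ i * 32 ^ k) * ε * (γ * N) ≤ 4 * 16384 ^ k * 1 * (γ * N) := by gcongr
    have a3 : 16 ^ i * 1024 ^ k * (γ * N) ≤ 16 ^ k * 1024 ^ k * (γ * N) := by gcongr; norm_num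
    rw [← p2] at a3
    have : 16 ^ i * (4 * 8 ^ i * ε * s + 1024 ^ k * γ * N) =
      4 * 128 ^ i * ε * s + 16 ^ i * 1024 ^ k * (γ * N) := by rw [p1]; ring
    rw [this]
    linarith
  have q2 : 16 ^ i * ∑ A ∈ powersetCard i univ, ∑ B ∈ powersetCard i univ,
      wsum μ (lev μ ∅ A f * lev μ ∅ A f * (lev μ ∅ B f * lev μ ∅ B f)) ≤
      16 ^ i * (4 * 8 ^ i * ε * s + 1024 ^ k * γ * N) := by gcongr
  have q3 : 16 ^ k * (64 ^ k * γ * N) ≤ 16384 ^ k * (γ * N) := by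
    have : 16 ^ k * (64 ^ k * γ * N) = 1024 ^ k * (γ * N) := by rw [p3]; ring
    rw [this]; gcongr
  linarith

/-- Young's inequality against an idempotent function. -/
lemma pow_mul_wsum_mul_le (hμ : 0 ≤ μ) {f : (ι → V) → ℝ} (hff : f * f = f) {l : ℝ} (hl : 0 ≤ l)
    (Z : (ι → V) → ℝ) :
    l ^ 3 * wsum μ (f * Z) ≤ l ^ 4 * wsum μ f + wsum μ (Z * Z * (Z * Z)) := by
  rw [← smul_eq_mul (l ^ 3), ← smul_eq_mul (l ^ 4), ← map_smul, ← map_smul, ← map_add]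
  refine wsum_mono hμ fun t => ?_
  simp only [Pi.mul_apply, Pi.add_apply, Pi.smul_apply, smul_eq_mul]
  have hft := congrFun hff t
  have : f t = 0 ∨ f t = 1 := by
    have : f t * (f t - 1) = 0 := by
      have : f t * f t = f t := hft
      linarith
    rcases mul_eq_zero.1 this with h0 | h0
    · exact Or.inl h0
    · exact Or.inr (by linarith)
  rcases this with h0 | h0
  · rw [h0]
    have := mul_nonneg (mul_self_nonneg (Z t)) (mul_self_nonneg (Z t))
    linarith
  · rw [h0]
    rcases le_total (Z t) l with hz | hz
    · have h5 : l ^ 3 * Z t ≤ l ^ 3 * l := by gcongr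
      have := mul_nonneg (mul_self_nonneg (Z t)) (mul_self_nonneg (Z t))
      nlinarith
    · have h5 : l ^ 3 * Z t ≤ Z t ^ 3 * Z t := by
        have : 0 ≤ Z t := hl.trans hz
        gcongr
      have : 0 ≤ l ^ 4 := by positivity
      nlinarith

lemma le_of_fourth_moment_le {W N M e δ : ℝ} {i : ℕ} (hi : 1 ≤ i) (hW : 0 ≤ W) (hN : 0 ≤ N)
    (he : 0 < e) (hM : M ≤ 4 * 128 ^ i * e ^ 3 * W + δ * N) (hδ : δ ≤ e ^ 4)
    (hyoung : (2 * 8 ^ i * e) ^ 3 * W ≤ (2 * 8 ^ i * e) ^ 4 * N + M) : W ≤ 1024 ^ i * e * N := by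
  have hl3 : (2 * 8 ^ i * e) ^ 3 = 8 * 512 ^ i * e ^ 3 := by
    rw [mul_pow, mul_pow, ← pow_mul, mul_comm i 3, pow_mul]; norm_num
  have h6 : 4 * 128 ^ i * e ^ 3 * W ≤ 4 * 512 ^ i * e ^ 3 * W := by gcongr; norm_num
  have h7 : δ * N ≤ e ^ 4 * N := by gcongr
  have h8 : e ^ 3 * (4 * 512 ^ i * W) ≤ e ^ 3 * ((16 * 512 ^ i * 8 ^ i * e + e) * N) := by
    have e4 : (2 * 8 ^ i * e) ^ 4 = 16 * 512 ^ i * 8 ^ i * e ^ 4 := by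
      rw [pow_succ, hl3]; ring
    rw [hl3, e4] at hyoung
    linarith
  have h9 := le_of_mul_le_mul_left h8 (by positivity)
  have h512 : (1 : ℝ) ≤ 512 ^ i := one_le_pow₀ (by norm_num)
  have h10 : 4 * 512 ^ i * W ≤ 4 * 512 ^ i * ((4 * 8 ^ i + 1) * e * N) := by
    have heN : 0 ≤ e * N := by positivity
    have : e * N ≤ 4 * 512 ^ i * (e * N) := by nlinarith
    linarith
  have h11 := le_of_mul_le_mul_left h10 (by positivity)
  refine h11.trans ?_
  gcongr
  have h8i : (8 : ℝ) ≤ 8 ^ i := by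
    calc (8 : ℝ) = 8 ^ 1 := by norm_num
      _ ≤ _ := pow_le_pow_right₀ (by norm_num) hi
  calc (4 * 8 ^ i + 1 : ℝ) ≤ 8 ^ i * 8 ^ i := by nlinarith
    _ = 64 ^ i := by rw [← mul_pow]; norm_num
    _ ≤ _ := by gcongr; norm_num

/-- Level inequality for a weighted product set whose pairwise conditional correlations are
tiny. -/
theorem PairwiseCovLE.level_inequality (hμ : 0 ≤ μ) (hγ : 0 ≤ γ) (h : PairwiseCovLE μ γ)
    (hsmall : (2 ^ 20) ^ Fintype.card ι * γ ≤ 1) {f : (ι → V) → ℝ} (hf : 0 ≤ f) (hf1 : f ≤ 1)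
    (hff : f * f = f) {e : ℝ} {i : ℕ}
    (hε : ∀ S : Finset ι, S.card ≤ i → ∀ t, condE μ S f t ≤ e ^ 3)
    (he0 : 0 ≤ e) (he1 : e ≤ 1) (hi : i ≤ Fintype.card ι) (hi1 : 1 ≤ i) :
    ∑ B ∈ powersetCard i univ, wsum μ (f * lev μ ∅ B f) ≤ 1024 ^ i * e * wsum μ f := by
  have hN : 0 ≤ wsum μ f := wsum_nonneg hμ hf
  set k := Fintype.card ι with hk
  have hsmall' : 64 ^ k * γ ≤ 1 := by
    refine le_trans ?_ hsmall
    gcongr; norm_num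
  have h4 := h.wsum_fourth_le_weight hμ hγ hsmall' hf hf1 hff hε (by positivity)
    (pow_le_one₀ he0 he1) hi
  set W := ∑ B ∈ powersetCard i univ, wsum μ (f * lev μ ∅ B f) with hW
  set N := wsum μ f with hNdef
  rcases le_total ((2 : ℝ) ^ k * e ^ 2) 1 with hc | hc
  · have htriv : W ≤ 2 ^ k * (2 ^ i * e ^ 3 * N) := by
      calc W ≤ ∑ B ∈ powersetCard i (univ : Finset ι), 2 ^ i * e ^ 3 * N := by
            refine sum_le_sum fun B hB => ?_
            rw [hNdef, ← smul_eq_mul (2 ^ i * e ^ 3), ← map_smul]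
            refine wsum_mono hμ fun t => ?_
            have hBi := (mem_powersetCard.1 hB).2
            have hb := abs_lev_le (μ := μ) (T := ∅) (P := B) (F := f) (c := e ^ 3) (fun S hS t => by
              rw [abs_of_nonneg (condE_nonneg hμ S hf t)]
              refine hε S ?_ t
              rw [empty_union] at hS
              exact (card_le_card hS).trans_eq hBi) t
            rw [hBi] at hb
            simp only [Pi.mul_apply, Pi.smul_apply, smul_eq_mul]
            rw [mul_comm]
            exact mul_le_mul_of_nonneg_right ((le_abs_self _).trans hb) (hf t)
        _ ≤ _ := by
            rw [sum_const, nsmul_eq_mul]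
            gcongr
            exact card_powersetCard_univ_le i
    refine htriv.trans ?_
    calc 2 ^ k * (2 ^ i * e ^ 3 * N) = 2 ^ i * e * N * (2 ^ k * e ^ 2) := by ring
      _ ≤ 2 ^ i * e * N * 1 := by gcongr
      _ ≤ _ := by rw [mul_one]; gcongr; norm_num
  · rcases le_total W 0 with hW0 | hW0
    · exact hW0.trans (by positivity)
    have he : 0 < e := by
      rcases he0.eq_or_lt with rfl | he
      · norm_num at hc
      · exact he
    set l := 2 * 8 ^ i * e with hl
    have hlpos : 0 < l := by positivity
    set Z := ∑ A ∈ powersetCard i univ, lev μ ∅ A f with hZ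
    have hWZ : W = wsum μ (f * Z) := by rw [hW, hZ, mul_sum, map_sum]
    have hyoung : l ^ 3 * W ≤ l ^ 4 * N + wsum μ (Z * Z * (Z * Z)) := by
      rw [hWZ]
      exact pow_mul_wsum_mul_le hμ hff hlpos.le Z
    have hδ : 6 * 16384 ^ k * γ ≤ e ^ 4 := by
      have e1 : 1 ≤ (4 : ℝ) ^ k * e ^ 4 := by
        have := one_le_pow₀ hc (n := 2)
        rw [mul_pow, ← pow_mul, ← pow_mul, mul_comm k 2, pow_mul] at this
        norm_num at this
        exact this
      have e2 : (6 : ℝ) ≤ 16 ^ k := by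
        calc (6 : ℝ) ≤ 16 ^ 1 := by norm_num
          _ ≤ _ := pow_le_pow_right₀ (by norm_num) (by omega)
      calc 6 * 16384 ^ k * γ = 6 * 16384 ^ k * γ * 1 := by ring
        _ ≤ 16 ^ k * 16384 ^ k * γ * (4 ^ k * e ^ 4) := by gcongr
        _ = (16 * 16384 * 4) ^ k * γ * e ^ 4 := by rw [mul_pow, mul_pow]; ring
        _ = (2 ^ 20) ^ k * γ * e ^ 4 := by norm_num
        _ ≤ 1 * e ^ 4 := by gcongr
        _ = _ := one_mul _
    exact le_of_fourth_moment_le hi1 hW0 hN he h4 hδ hyoung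

end FiniteProduct

namespace WSC

variable (X : WSC n d)

lemma w_eq_zero_of_card_ne {i : ℕ} {s : Finset (Fin n)} (h : s.card ≠ i) : X.w i s = 0 :=
  X.w_zero i s fun hs => h (X.card_mem i s hs)

lemma mem_faces_of_w_ne_zero {i : ℕ} {s : Finset (Fin n)} (h : X.w i s ≠ 0) : s ∈ X.faces i := by
  by_contra hs
  exact h (X.w_zero i s hs)

lemma le_of_mem_faces {i : ℕ} {s : Finset (Fin n)} (hs : s ∈ X.faces i) : i ≤ d := by
  by_contra h
  rw [X.empty_levels i (by omega)] at hs
  simp at hs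

lemma mem_faces_of_subset_of_card_add (m : ℕ) : ∀ {i : ℕ} {s r : Finset (Fin n)},
    s ∈ X.faces i → r ⊆ s → r.card + m = i → r ∈ X.faces r.card := by
  induction m with
  | zero =>
    intro i s r hs hr hc
    have : r = s := eq_of_subset_of_card_le hr (by rw [X.card_mem i s hs]; omega)
    rw [this, X.card_mem i s hs]
    exact hs
  | succ m ih =>
    intro i s r hs hr hc
    obtain ⟨t, hrt, hts, htc⟩ := exists_subsuperset_card_eq hr (Nat.le_succ r.card)
      (by rw [X.card_mem i s hs]; omega)
    have ht := ih hs hts (by omega)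
    rw [htc] at ht
    have := X.le_of_mem_faces ht
    exact (X.downward _ (by omega) r).2 ⟨rfl, t, ht, hrt⟩

lemma mem_faces_of_subset {i : ℕ} {s r : Finset (Fin n)} (hs : s ∈ X.faces i) (hr : r ⊆ s) :
    r ∈ X.faces r.card :=
  X.mem_faces_of_subset_of_card_add (i - r.card) hs hr (by
    have := card_le_card hr
    rw [X.card_mem i s hs] at this
    omega)

lemma sum_superset {j : ℕ} {s : Finset (Fin n)} (hs : s.card = j) (h : Cf n) :
    ∑ t ∈ (X.faces (j + 1)).filter (fun t => s ⊆ t), X.w (j + 1) t * h t =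
      ∑ v, X.w (j + 1) (insert v s) * h (insert v s) := by
  rw [← sum_filter_of_ne (p := fun v => insert v s ∈ X.faces (j + 1)) (s := univ)
    (fun v _ hv => X.mem_faces_of_w_ne_zero (left_ne_zero_of_mul hv))]
  have hnot {v : Fin n} (hv : insert v s ∈ X.faces (j + 1)) : v ∉ s := fun hvs => by
    have := X.card_mem _ _ hv
    rw [insert_eq_of_mem hvs] at this
    omega
  symm
  refine sum_of_injOn (fun v => insert v s) ?_ ?_ ?_ fun _ _ => rfl
  · intro u hu v hv huv
    have hu := hnot (by simpa using hu)
    exact (insert_inj hu).1 huv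
  · intro v hv
    simp only [coe_filter, mem_univ, true_and, Set.mem_ofPred_eq] at hv ⊢
    exact ⟨hv, subset_insert _ _⟩
  · intro t ht hne
    simp only [mem_filter] at ht
    exfalso
    apply hne
    have hc := X.card_mem _ _ ht.1
    obtain ⟨v, hv⟩ : ∃ v, t \ s = {v} := card_eq_one.1 (by
      rw [card_sdiff_of_subset ht.2]; omega)
    have hins : insert v s = t := by
      rw [insert_eq, ← hv, sdiff_union_of_subset ht.2]
    refine ⟨v, ?_, hins⟩
    simp [hins, ht.1]

/-- A sequence of functions on faces, each of which is the average of the next one. -/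
def IsMartingale (k : ℕ) (h : ℕ → Cf n) : Prop :=
  ∀ j < k, ∀ s : Finset (Fin n), s.card ≤ j →
    ∑ v, X.w (j + 1) (insert v s) * h (j + 1) (insert v s) = (j + 1) * (X.w j s * h j s)

variable {X}

lemma isMartingale_of_mem_faces {k : ℕ} {h : ℕ → Cf n}
    (H : ∀ j < k, ∀ s ∈ X.faces j,
      ∑ v, X.w (j + 1) (insert v s) * h (j + 1) (insert v s) = (j + 1) * (X.w j s * h j s)) :
    X.IsMartingale k h := by
  intro j hj s hsj
  by_cases hs : s ∈ X.faces j
  · exact H j hj s hs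
  rw [X.w_zero j s hs, zero_mul, mul_zero]
  refine sum_eq_zero fun v _ => ?_
  rw [X.w_zero, zero_mul]
  intro hv
  apply hs
  have hc := X.card_mem _ _ hv
  have := card_insert_le v s
  have hsj : s.card = j := by omega
  rw [← hsj]
  exact X.mem_faces_of_subset hv (subset_insert _ _)

lemma sum_w_insert {j : ℕ} (hj : j < d) {s : Finset (Fin n)} (hs : s ∈ X.faces j) :
    ∑ v, X.w (j + 1) (insert v s) = (j + 1) * X.w j s := by
  have h1 := X.sum_superset (X.card_mem j s hs) 1
  simp only [Pi.one_apply, mul_one] at h1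
  rw [← h1, X.w_rec j hj s hs]
  field_simp

lemma isMartingale_one {k : ℕ} (hk : k ≤ d) : X.IsMartingale k fun _ => 1 :=
  isMartingale_of_mem_faces fun j hj s hs => by
    simpa using sum_w_insert (hj.trans_le hk) hs

lemma isMartingale_Dc {k : ℕ} (hk : k ≤ d) (f : Cf n) :
    X.IsMartingale k fun j => Dc X k (k - j) f :=
  isMartingale_of_mem_faces fun j hj s hs => by
    have hsub : k - j = (k - (j + 1)) + 1 := by omega
    have hsub' : k - (k - (j + 1) + 1) = j := by omega
    rw [hsub, Dc, hsub', Dop, X.sum_superset (X.card_mem j s hs)]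
    have h1 := X.sum_superset (X.card_mem j s hs) 1
    simp only [Pi.one_apply, mul_one] at h1
    rw [h1, sum_w_insert (hj.trans_le hk) hs]
    have := X.w_pos j s hs
    field_simp

lemma IsMartingale.sum_filter_superset {k : ℕ} {h : ℕ → Cf n} (H : X.IsMartingale k h) (m : ℕ) :
    ∀ {j : ℕ} {s : Finset (Fin n)}, j + m = k → s.card = j →
      ∑ ρ ∈ (X.faces k).filter (fun ρ => s ⊆ ρ), X.w k ρ * h k ρ =
        k.choose j * (X.w j s * h j s) := by
  induction m with
  | zero =>
    rintro j s rfl hs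
    rw [add_zero, Nat.choose_self, Nat.cast_one, one_mul]
    rw [sum_eq_single s]
    · intro ρ hρ hne
      simp only [mem_filter] at hρ
      exact absurd (eq_of_subset_of_card_le hρ.2 (by rw [X.card_mem _ _ hρ.1]; omega)).symm hne
    · intro hns
      rw [X.w_zero, zero_mul]
      intro hs'
      exact hns (by simpa using hs')
  | succ m ih =>
    intro j s hjm hs
    have hjk : j < k := by omega
    have e1 : ∑ v ∈ sᶜ, ∑ ρ ∈ (X.faces k).filter (fun ρ => insert v s ⊆ ρ), X.w k ρ * h k ρ =
        ∑ v, k.choose (j + 1) * (X.w (j + 1) (insert v s) * h (j + 1) (insert v s)) := by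
      rw [← sum_subset (subset_univ sᶜ)]
      · refine sum_congr rfl fun v hv => ih (by omega) ?_
        rw [card_insert_of_notMem (by simpa using hv), hs]
      · intro v _ hv
        rw [X.w_eq_zero_of_card_ne]
        · simp
        · rw [insert_eq_of_mem (by simpa using hv)]; omega
    rw [← mul_sum, H j hjk s hs.le] at e1
    have e2 : ∑ v ∈ sᶜ, ∑ ρ ∈ (X.faces k).filter (fun ρ => insert v s ⊆ ρ), X.w k ρ * h k ρ =
        (m + 1) * ∑ ρ ∈ (X.faces k).filter (fun ρ => s ⊆ ρ), X.w k ρ * h k ρ := by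
      simp only [sum_filter]
      rw [sum_comm, mul_sum]
      refine sum_congr rfl fun ρ hρ => ?_
      split_ifs with hsρ
      · have : ∀ v, (insert v s ⊆ ρ) = (v ∈ ρ) := fun v => by
          rw [insert_subset_iff]; simp [hsρ]
        simp only [this]
        rw [← sum_filter, sum_const, nsmul_eq_mul]
        congr 1
        have : sᶜ.filter (fun v => v ∈ ρ) = ρ \ s := by ext; simp [and_comm]
        rw [this, card_sdiff_of_subset hsρ, X.card_mem _ _ hρ, hs, show k - j = m + 1 by omega]
        simp
      · rw [mul_zero]
        refine sum_eq_zero fun v _ => if_neg fun hv => hsρ ((subset_insert _ _).trans hv)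
    rw [e2] at e1
    have e3 : (k.choose (j + 1) : ℝ) * (j + 1) = k.choose j * (m + 1) := by
      have := Nat.choose_succ_right_eq k j
      rw [show k - j = m + 1 by omega] at this
      exact_mod_cast this
    have hm : (m + 1 : ℝ) ≠ 0 := by positivity
    apply mul_left_cancel₀ hm
    rw [e1, ← mul_assoc, e3]
    ring

lemma linkMean_eq_Dc {k j : ℕ} (hk : k ≤ d) (hj : j ≤ k) {s : Finset (Fin n)}
    (hs : s ∈ X.faces j) (f : Cf n) : linkMean X k s f = Dc X k (k - j) f s := by
  have h1 := (isMartingale_one (X := X) hk).sum_filter_superset (k - j) (by omega)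
    (X.card_mem j s hs)
  have h2 := (isMartingale_Dc (X := X) hk f).sum_filter_superset (k - j) (by omega)
    (X.card_mem j s hs)
  simp only [Pi.one_apply, mul_one, Nat.sub_self, Dc] at h1 h2
  rw [linkMean, h1, h2]
  have := X.w_pos j s hs
  have : (0 : ℝ) < k.choose j := by exact_mod_cast Nat.choose_pos hj
  field_simp

lemma EE_eq_Dc {k : ℕ} (hk : k ≤ d) (f : Cf n) :
    EE X k f = X.w 0 ∅ * Dc X k k f ∅ := by
  have h2 := (isMartingale_Dc (X := X) hk f).sum_filter_superset (j := 0) (s := ∅) k (by omega) rfl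
  simpa [Dc, EE] using h2

/-- Removing one point and then choosing `j` points, summed over all choices. -/
lemma sum_powersetCard_erase {α : Type*} [DecidableEq α] (s : Finset α) (j m : ℕ)
    (hs : s.card = j + m + 1) (g : Finset α → ℝ) :
    ∑ v ∈ s, ∑ T ∈ powersetCard j (s.erase v), g T = (m + 1) * ∑ T ∈ powersetCard j s, g T := by
  have : ∀ v ∈ s, ∑ T ∈ powersetCard j (s.erase v), g T =
      ∑ T ∈ powersetCard j s, if v ∉ T then g T else 0 := fun v _ => by
    rw [← sum_filter]
    refine sum_congr ?_ fun _ _ => rfl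
    ext T
    simp only [mem_powersetCard, mem_filter, subset_erase]
    tauto
  rw [sum_congr rfl this, sum_comm, mul_sum]
  refine sum_congr rfl fun T hT => ?_
  rw [mem_powersetCard] at hT
  rw [← sum_filter, sum_const, nsmul_eq_mul, filter_notMem_eq_sdiff, card_sdiff_of_subset hT.1, hs,
    hT.2, show j + m + 1 - j = m + 1 by omega]
  push_cast
  ring

lemma Uc_apply (g : Cf n) (j m : ℕ) : ∀ {s : Finset (Fin n)}, s ∈ X.faces (j + m) →
    ((j + m).choose j : ℝ) * Uc X j m g s = ∑ T ∈ powersetCard j s, g T := by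
  induction m with
  | zero =>
    intro s hs
    have hc := X.card_mem _ _ hs
    rw [add_zero] at hc
    have : powersetCard j s = {s} := by rw [← hc, powersetCard_self]
    simp [this, Uc]
  | succ m ih =>
    intro s hs
    have hc : s.card = j + m + 1 := X.card_mem _ _ hs
    have hfil : (X.faces (j + m)).filter (fun σ => σ ⊆ s) = s.image s.erase := by
      ext σ
      simp only [mem_filter, mem_image]
      constructor
      · rintro ⟨h1, h2⟩
        obtain ⟨v, hv⟩ : ∃ v, s \ σ = {v} := card_eq_one.1 (by
          rw [card_sdiff_of_subset h2, X.card_mem _ _ h1]; omega)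
        have hvs : v ∈ s \ σ := by rw [hv]; simp
        refine ⟨v, (mem_sdiff.1 hvs).1, ?_⟩
        rw [erase_eq, ← hv, Finset.sdiff_sdiff_eq_self h2]
      · rintro ⟨v, hv, rfl⟩
        refine ⟨?_, erase_subset _ _⟩
        have := X.mem_faces_of_subset hs (erase_subset v s)
        rwa [card_erase_of_mem hv, hc] at this
    have hU : (j + m + 1 : ℝ) * Uc X j (m + 1) g s = ∑ v ∈ s, Uc X j m g (s.erase v) := by
      rw [Uc, Uop, hfil, sum_image (erase_injOn s)]
      push_cast
      have : (j + m + 1 : ℝ) ≠ 0 := by positivity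
      field_simp
    have hsum : ((j + m).choose j : ℝ) * ∑ v ∈ s, Uc X j m g (s.erase v) =
        (m + 1) * ∑ T ∈ powersetCard j s, g T := by
      rw [← sum_powersetCard_erase s j m hc g, mul_sum]
      refine sum_congr rfl fun v hv => ih ?_
      have := X.mem_faces_of_subset hs (erase_subset v s)
      rwa [card_erase_of_mem hv, hc] at this
    rw [← hU] at hsum
    have e3 : ((j + m + 1).choose j : ℝ) * (m + 1) = (j + m).choose j * (j + m + 1) := by
      have := Nat.choose_mul_succ_eq (j + m) j
      rw [show j + m + 1 - j = m + 1 by omega] at this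
      exact_mod_cast this.symm
    have hm : (m + 1 : ℝ) ≠ 0 := by positivity
    apply mul_left_cancel₀ hm
    rw [← hsum, ← mul_assoc, ← mul_assoc, ← e3, add_assoc j m 1]
    ring

lemma fLevel_apply {k i : ℕ} (hi : i ≤ k) (f : Cf n) {s : Finset (Fin n)} (hs : s ∈ X.faces k) :
    fLevel X k f i s = ∑ T ∈ powersetCard i s, gLevel X k f i T := by
  have hk : i + (k - i) = k := by omega
  have := Uc_apply (X := X) (gLevel X k f i) i (k - i) (s := s) (by rwa [hk])
  rw [hk] at this
  simpa [fLevel] using this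

lemma sum_gLevel (k : ℕ) (f : Cf n) {i : ℕ} {s : Finset (Fin n)} (hs : s ∈ X.faces i) :
    ∑ T ∈ s.powerset, gLevel X k f T.card T = Dc X k (k - i) f s := by
  have hc := X.card_mem _ _ hs
  have hpow (j : ℕ) (hj : j ≤ i) : (i.choose j : ℝ) * Uc X j (i - j) (gLevel X k f j) s =
      ∑ T ∈ powersetCard j s, gLevel X k f T.card T := by
    have hk : j + (i - j) = i := by omega
    have := Uc_apply (X := X) (gLevel X k f j) j (i - j) (s := s) (by rwa [hk])
    rw [hk] at this
    rw [this]
    exact sum_congr rfl fun T hT => by rw [(mem_powersetCard.1 hT).2]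
  rw [sum_powerset, hc, sum_range_succ]
  have htop : ∑ T ∈ powersetCard i s, gLevel X k f T.card T = gLevel X k f i s := by
    have : powersetCard i s = {s} := by rw [← hc, powersetCard_self]
    rw [this, sum_singleton, hc]
  rw [htop, gLevel]
  simp only [Pi.sub_apply, Finset.sum_apply, Pi.smul_apply, smul_eq_mul]
  rw [sum_attach (range i) fun j => (i.choose j : ℝ) * Uc X j (i - j) (gLevel X k f j) s,
    sum_congr rfl fun j hj => hpow j (mem_range.1 hj).le]
  ring

lemma sum_powerset_moebius {α : Type*} [DecidableEq α] {G E : Finset α → ℝ} {s : Finset α}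
    (h : ∀ T ⊆ s, ∑ R ∈ T.powerset, G R = E T) :
    G s = ∑ T ∈ s.powerset, (-1 : ℝ) ^ (s \ T).card * E T := by
  have e1 : ∑ T ∈ s.powerset, (-1 : ℝ) ^ (s \ T).card * E T =
      ∑ R ∈ s.powerset, G R * ∑ T ∈ s.powerset with R ⊆ T, (-1 : ℝ) ^ (s \ T).card := by
    simp only [sum_filter, mul_sum]
    rw [sum_comm]
    refine sum_congr rfl fun T hT => ?_
    have hTs := mem_powerset.1 hT
    rw [← h T hTs, mul_sum]
    simp only [mul_ite, mul_zero]
    rw [← sum_filter]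
    refine sum_congr ?_ fun _ _ => mul_comm _ _
    ext R
    simp only [mem_powerset, mem_filter]
    exact ⟨fun hR => ⟨hR.trans hTs, hR⟩, fun hR => hR.2⟩
  have e2 (R : Finset α) (hR : R ⊆ s) : ∑ T ∈ s.powerset with R ⊆ T, (-1 : ℝ) ^ (s \ T).card =
      if R = s then 1 else 0 := by
    have : ∑ T ∈ s.powerset with R ⊆ T, (-1 : ℝ) ^ (s \ T).card =
        ∑ Q ∈ (s \ R).powerset, (-1 : ℝ) ^ Q.card := by
      refine sum_bij' (fun T _ => s \ T) (fun Q _ => s \ Q) ?_ ?_ ?_ ?_ ?_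
      · intro T hT
        simp only [mem_filter, mem_powerset] at hT ⊢
        exact sdiff_subset_sdiff le_rfl hT.2
      · intro Q hQ
        simp only [mem_filter, mem_powerset] at hQ ⊢
        refine ⟨sdiff_subset, fun x hx => mem_sdiff.2 ⟨hR hx, fun hxQ => ?_⟩⟩
        exact (mem_sdiff.1 (hQ hxQ)).2 hx
      · intro T hT
        simp only [mem_filter, mem_powerset] at hT
        exact Finset.sdiff_sdiff_eq_self hT.1
      · intro Q hQ
        exact Finset.sdiff_sdiff_eq_self ((mem_powerset.1 hQ).trans sdiff_subset)
      · intro T hT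
        rfl
    rw [this]
    have hz := sum_powerset_neg_one_pow_card (x := s \ R)
    have hz' : ∑ Q ∈ (s \ R).powerset, (-1 : ℝ) ^ Q.card = if s \ R = ∅ then 1 else 0 := by
      exact_mod_cast congrArg (Int.cast : ℤ → ℝ) hz
    rw [hz']
    refine if_congr ?_ rfl rfl
    rw [sdiff_eq_empty_iff_subset]
    exact ⟨fun hs => hR.antisymm hs, fun hs => hs ▸ Subset.rfl⟩
  rw [e1, sum_congr rfl fun R hR => by rw [e2 R (mem_powerset.1 hR)]]
  simp

lemma gLevel_apply (k : ℕ) (f : Cf n) {i : ℕ} {s : Finset (Fin n)} (hs : s ∈ X.faces i) :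
    gLevel X k f i s =
      ∑ T ∈ s.powerset, (-1 : ℝ) ^ (s \ T).card * Dc X k (k - T.card) f T := by
  have := sum_powerset_moebius (G := fun T => gLevel X k f T.card T)
    (E := fun T => Dc X k (k - T.card) f T) (s := s)
    fun T hT => sum_gLevel k f (X.mem_faces_of_subset hs hT)
  rwa [X.card_mem _ _ hs] at this

end WSC

section Tuples

variable {ι : Type*} [Fintype ι] [DecidableEq ι]

lemma sum_sum_update {V : Type*} [Fintype V] (x : ι) (G : (ι → V) → ℝ) :
    ∑ t : ι → V, ∑ u : V, G (Function.update t x u) = Fintype.card V * ∑ t, G t := by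
  have : ∑ p : (ι → V) × V, G (Function.update p.1 x p.2) = ∑ p : (ι → V) × V, G p.1 := by
    refine Fintype.sum_equiv
      (Function.Involutive.toPerm (fun p => (Function.update p.1 x p.2, p.1 x)) fun p => ?_) _ _
      fun p => rfl
    simp
  rw [← Fintype.sum_prod_type', this, Fintype.sum_prod_type]
  simp [mul_sum]

/-- The weight of the sub-tuple of `t` indexed by `S`. -/
noncomputable def tupleWeight (X : WSC n d) (S : Finset ι) (t : ι → Fin n) : ℝ :=
  X.w S.card (S.image t) / S.card.factorial

variable {X : WSC n d}

lemma tupleWeight_nonneg (S : Finset ι) : 0 ≤ tupleWeight X S := fun _ =>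
  div_nonneg (X.w_nonneg _ _) (Nat.cast_nonneg _)

lemma image_update_insert {S : Finset ι} {x : ι} (hx : x ∉ S) (t : ι → Fin n) (u : Fin n) :
    (insert x S).image (Function.update t x u) = insert u (S.image t) := by
  rw [image_insert, Function.update_self]
  congr 1
  refine image_congr fun y hy => Function.update_of_ne ?_ _ _
  rintro rfl
  exact hx hy

lemma tupleWeight_update {S : Finset ι} {x : ι} (hx : x ∉ S) (t : ι → Fin n) (u : Fin n) :
    tupleWeight X (insert x S) (Function.update t x u) =
      X.w (S.card + 1) (insert u (S.image t)) / (S.card + 1).factorial := by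
  rw [tupleWeight, image_update_insert hx, card_insert_of_notMem hx]

lemma DependsOn.update_of_notMem {V : Type*} {F : (ι → V) → ℝ} {S : Finset ι}
    (hF : DependsOn F (S : Set ι)) {x : ι} (hx : x ∉ S) (t : ι → V) (u : V) :
    F (Function.update t x u) = F t :=
  hF fun y hy => Function.update_of_ne (by rintro rfl; exact hx hy) _ _

lemma dependsOn_image (S : Finset ι) (h : Cf n) :
    DependsOn (fun t : ι → Fin n => h (S.image t)) (S : Set ι) := fun t u htu => by
  have : S.image t = S.image u := image_congr fun y hy => htu y hy
  simp only [this]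

lemma WSC.IsMartingale.sum_insert {k : ℕ} {h : ℕ → Cf n} (H : X.IsMartingale k h) {S : Finset ι}
    {x : ι} (hx : x ∉ S) (hS : S.card < k) {F : (ι → Fin n) → ℝ} (hF : DependsOn F (S : Set ι)) :
    n * ∑ t, tupleWeight X (insert x S) t * h (S.card + 1) ((insert x S).image t) * F t =
      ∑ t, tupleWeight X S t * h S.card (S.image t) * F t := by
  have := sum_sum_update x
    fun t => tupleWeight X (insert x S) t * h (S.card + 1) ((insert x S).image t) * F t
  rw [Fintype.card_fin] at this
  rw [← this]
  refine sum_congr rfl fun t _ => ?_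
  simp only [tupleWeight_update hx, image_update_insert hx, hF.update_of_notMem hx]
  rw [← sum_mul]
  congr 1
  have hm := H S.card hS (S.image t) card_image_le
  simp only [div_mul_eq_mul_div]
  rw [← sum_div, hm, tupleWeight, Nat.factorial_succ]
  push_cast
  have : (S.card + 1 : ℝ) ≠ 0 := by positivity
  have : (S.card.factorial : ℝ) ≠ 0 := by positivity
  field_simp

lemma WSC.IsMartingale.sum_union {k : ℕ} {h : ℕ → Cf n} (H : X.IsMartingale k h) {S : Finset ι}
    (T : Finset ι) (hd : Disjoint S T) (hST : (S ∪ T).card ≤ k)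
    {F : (ι → Fin n) → ℝ} (hF : DependsOn F (S : Set ι)) :
    (n : ℝ) ^ T.card *
        ∑ t, tupleWeight X (S ∪ T) t * h (S ∪ T).card ((S ∪ T).image t) * F t =
      ∑ t, tupleWeight X S t * h S.card (S.image t) * F t := by
  induction T using Finset.induction_on with
  | empty => simp
  | insert x T hx ih =>
    rw [disjoint_insert_right] at hd
    have hxST : x ∉ S ∪ T := by simp [hx, hd.1]
    rw [union_insert, card_insert_of_notMem hxST] at hST
    rw [← ih hd.2 (by omega), ← H.sum_insert hxST (by omega)
      (hF.mono_finset subset_union_left), union_insert, card_insert_of_notMem hx,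
      card_insert_of_notMem hxST, pow_succ, mul_assoc]

/-- Functions of the coordinates in `S` are integrated equally well by the weights of the
sub-tuples indexed by `S`, up to normalisation. -/
lemma sum_tupleWeight_mul (hk : Fintype.card ι ≤ d) {S T : Finset ι} (hd : Disjoint S T)
    {F : (ι → Fin n) → ℝ} (hF : DependsOn F (S : Set ι)) :
    (n : ℝ) ^ T.card * ∑ t, tupleWeight X (S ∪ T) t * F t = ∑ t, tupleWeight X S t * F t := by
  simpa using (WSC.isMartingale_one (X := X) hk).sum_union T hd (card_le_univ _) hF

/-- The weights on tuples of vertices obtained by ordering a random face uniformly. -/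
noncomputable abbrev orderedWeight (X : WSC n d) (ι : Type*) [Fintype ι] [DecidableEq ι] :
    (ι → Fin n) → ℝ := tupleWeight X (univ : Finset ι)

lemma pow_ne_zero_of_nonempty [h : Nonempty (ι → Fin n)] (S : Finset ι) :
    (n : ℝ) ^ S.card ≠ 0 := by
  rcases S.eq_empty_or_nonempty with rfl | ⟨x, _⟩
  · simp
  · obtain ⟨t⟩ := h
    have : 0 < n := (Nat.zero_le _).trans_lt (t x).2
    positivity

lemma pow_mul_wsum_orderedWeight (hk : Fintype.card ι ≤ d) (S : Finset ι)
    {F : (ι → Fin n) → ℝ} (hF : DependsOn F (S : Set ι)) :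
    (n : ℝ) ^ Sᶜ.card * wsum (orderedWeight X ι) F = ∑ t, tupleWeight X S t * F t := by
  have := sum_tupleWeight_mul (X := X) hk (disjoint_compl_right (a := S)) hF
  rwa [union_compl] at this

lemma WSC.IsMartingale.wsum_mul_eq (hk : Fintype.card ι ≤ d) {h : ℕ → Cf n}
    (H : X.IsMartingale (Fintype.card ι) h) (S : Finset ι) {F : (ι → Fin n) → ℝ}
    (hF : DependsOn F (S : Set ι)) :
    wsum (orderedWeight X ι) ((fun t => h (Fintype.card ι) (univ.image t)) * F) =
      wsum (orderedWeight X ι) ((fun t => h S.card (S.image t)) * F) := by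
  rcases isEmpty_or_nonempty (ι → Fin n) with he | he
  · simp [wsum_apply]
  apply mul_left_cancel₀ (pow_ne_zero_of_nonempty (n := n) Sᶜ)
  rw [pow_mul_wsum_orderedWeight hk S (dependsOn_mul (dependsOn_image S _) hF)]
  have := H.sum_union Sᶜ disjoint_compl_right (card_le_univ _) hF
  rw [union_compl, card_univ] at this
  simp only [wsum_apply, Pi.mul_apply, ← mul_assoc]
  exact this

/-- Integrating a function of the underlying face. -/
lemma wsum_image_univ (hk : Fintype.card ι ≤ d) (F : Cf n) :
    wsum (orderedWeight X ι) (fun t => F (univ.image t)) = EE X (Fintype.card ι) F := by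
  rcases isEmpty_or_nonempty (ι → Fin n) with he | he
  · rw [wsum_apply, Fintype.sum_empty, EE, eq_comm]
    refine sum_eq_zero fun s hs => ?_
    have hc := X.card_mem _ _ hs
    obtain ⟨e⟩ : Nonempty (ι ≃ s) := ⟨Fintype.equivOfCardEq (by simp [hc])⟩
    exact he.elim fun x => (e x).1
  rw [WSC.EE_eq_Dc hk]
  have H := WSC.isMartingale_Dc (X := X) hk F
  have hone : DependsOn (fun _ : ι → Fin n => (1 : ℝ)) ((∅ : Finset ι) : Set ι) := fun _ _ _ => rfl
  have h1 := H.sum_union (S := (∅ : Finset ι)) univ (by simp) (by simp) hone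
  simp only [empty_union, card_univ, Nat.sub_self, Dc, mul_one, card_empty, image_empty,
    tupleWeight, Nat.factorial_zero, Nat.sub_zero, sum_const, card_univ, Fintype.card_fun,
    Fintype.card_fin, nsmul_eq_mul, Nat.cast_one, div_one] at h1
  have hn := pow_ne_zero_of_nonempty (n := n) (univ : Finset ι)
  rw [card_univ] at hn
  apply mul_left_cancel₀ hn
  rw [wsum_apply]
  simp only [orderedWeight, tupleWeight, card_univ]
  rw [h1]
  push_cast
  ring

variable {γ : ℝ}

lemma edgeW_eq {c : ℕ} {s : Finset (Fin n)} (hs : s ∈ X.faces c) (u v : Fin n) :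
    edgeW X c s u v = X.w (c + 2) (insert u (insert v s)) := by
  rw [edgeW]
  split_ifs with h
  · rfl
  rw [X.w_zero]
  intro hf
  have hc := X.card_mem _ _ hf
  have hsc := X.card_mem _ _ hs
  have h1 := card_insert_le v s
  apply h
  refine ⟨?_, ?_, ?_, hf⟩
  · rintro rfl
    rw [insert_idem] at hc
    omega
  · intro hu
    rw [insert_eq_of_mem (mem_insert_of_mem hu)] at hc
    omega
  · intro hv
    rw [insert_eq_of_mem hv] at hc
    have := card_insert_le u s
    omega

lemma sum_w_insert_insert {c : ℕ} (hc : c + 2 ≤ d) {s : Finset (Fin n)} (hs : s.card ≤ c)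
    (u : Fin n) :
    ∑ v, X.w (c + 2) (insert u (insert v s)) = (c + 2) * X.w (c + 1) (insert u s) := by
  have := WSC.isMartingale_one (X := X) le_rfl (c + 1) (by omega) (insert u s)
    ((card_insert_le u s).trans (by omega))
  simp only [Pi.one_apply, mul_one] at this
  simp only [insert_comm u]
  rw [this]
  push_cast
  ring

lemma IsLSE.abs_sum_sum_le (h : IsLSE X γ) (hγ : 0 ≤ γ) {c : ℕ} (hc : c + 2 ≤ d)
    {s : Finset (Fin n)} (hs : s.card ≤ c) {α β : Fin n → ℝ}
    (hα : ∑ u, X.w (c + 1) (insert u s) * α u = 0)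
    (hβ : ∑ u, X.w (c + 1) (insert u s) * β u = 0) :
    |∑ u, ∑ v, X.w (c + 2) (insert u (insert v s)) * α u * β v| ≤
      γ / 2 * ((c + 2) * ∑ u, X.w (c + 1) (insert u s) * α u ^ 2 +
        (c + 2) * ∑ u, X.w (c + 1) (insert u s) * β u ^ 2) := by
  have hQ (α : Fin n → ℝ) : 0 ≤ ∑ u, X.w (c + 1) (insert u s) * α u ^ 2 :=
    sum_nonneg fun u _ => mul_nonneg (X.w_nonneg _ _) (sq_nonneg _)
  by_cases hf : s ∈ X.faces c
  swap
  · have hz : ∀ u v, X.w (c + 2) (insert u (insert v s)) = 0 := fun u v => X.w_zero _ _ fun hm => by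
      have h0 := X.card_mem _ _ hm
      have h1 := card_insert_le u (insert v s)
      have h2 := card_insert_le v s
      have h3 := X.mem_faces_of_subset hm ((subset_insert v s).trans (subset_insert u _))
      rw [show s.card = c by omega] at h3
      exact hf h3
    simp only [hz, zero_mul, sum_const_zero, abs_zero]
    have := hQ α
    have := hQ β
    positivity
  have hv (u : Fin n) : vertW X c s u = (c + 2) * X.w (c + 1) (insert u s) := by
    rw [vertW, ← sum_w_insert_insert hc hs u]
    exact sum_congr rfl fun v _ => edgeW_eq hf u v
  have key (f : Fin n → ℝ) (hf0 : ∑ u, X.w (c + 1) (insert u s) * f u = 0) :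
      |∑ u, ∑ v, X.w (c + 2) (insert u (insert v s)) * f u * f v| ≤
        γ * ((c + 2) * ∑ u, X.w (c + 1) (insert u s) * f u ^ 2) := by
    have := h c hc s hf f (by simp only [hv, mul_assoc, ← mul_sum, hf0, mul_zero])
    simpa only [hv, edgeW_eq hf, mul_assoc, ← mul_sum] using this
  have k1 := key (fun u => α u + β u) (by simp only [mul_add, sum_add_distrib, hα, hβ, add_zero])
  have k2 := key (fun u => α u - β u) (by simp only [mul_sub, sum_sub_distrib, hα, hβ, sub_zero])
  have hsymm : ∑ u, ∑ v, X.w (c + 2) (insert u (insert v s)) * β u * α v =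
      ∑ u, ∑ v, X.w (c + 2) (insert u (insert v s)) * α u * β v := by
    rw [sum_comm]
    refine sum_congr rfl fun u _ => sum_congr rfl fun v _ => ?_
    rw [insert_comm]
    ring
  have hpol : 4 * ∑ u, ∑ v, X.w (c + 2) (insert u (insert v s)) * α u * β v =
      (∑ u, ∑ v, X.w (c + 2) (insert u (insert v s)) * (α u + β u) * (α v + β v)) -
      ∑ u, ∑ v, X.w (c + 2) (insert u (insert v s)) * (α u - β u) * (α v - β v) := by
    have : 4 * ∑ u, ∑ v, X.w (c + 2) (insert u (insert v s)) * α u * β v =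
        2 * (∑ u, ∑ v, X.w (c + 2) (insert u (insert v s)) * α u * β v) +
        2 * ∑ u, ∑ v, X.w (c + 2) (insert u (insert v s)) * β u * α v := by rw [hsymm]; ring
    rw [this]
    simp only [mul_sum, ← sum_sub_distrib, ← sum_add_distrib]
    exact sum_congr rfl fun u _ => sum_congr rfl fun v _ => by ring
  have hpar : ∑ u, X.w (c + 1) (insert u s) * (α u + β u) ^ 2 +
      ∑ u, X.w (c + 1) (insert u s) * (α u - β u) ^ 2 =
      2 * (∑ u, X.w (c + 1) (insert u s) * α u ^ 2) +
      2 * ∑ u, X.w (c + 1) (insert u s) * β u ^ 2 := by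
    simp only [mul_sum, ← sum_add_distrib]
    exact sum_congr rfl fun u _ => by ring
  have k3 := (abs_sub _ _).trans (add_le_add k1 k2)
  rw [← hpol, ← mul_add, ← mul_add, hpar, abs_mul, abs_of_pos (by norm_num : (0 : ℝ) < 4)] at k3
  linarith

/-- The weighted sum over the values at `x` of a function of the coordinates in `insert x C`
vanishes if the function is orthogonal to the functions of the coordinates in `C`. -/
lemma sum_w_insert_mul_eq_zero (hk : Fintype.card ι ≤ d) {C : Finset ι} {x : ι} (hx : x ∉ C)
    {a : (ι → Fin n) → ℝ} (ha : DependsOn a ((insert x C : Finset ι) : Set ι))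
    (h0 : ∀ φ, DependsOn φ (C : Set ι) → wsum (orderedWeight X ι) (a * φ) = 0) (t : ι → Fin n) :
    ∑ u, X.w (C.card + 1) (insert u (C.image t)) * a (Function.update t x u) = 0 := by
  set φ : (ι → Fin n) → ℝ := fun t =>
    ∑ u, X.w (C.card + 1) (insert u (C.image t)) * a (Function.update t x u) with hφ
  have hdφ : DependsOn φ (C : Set ι) := fun t r htr => by
    have e1 : C.image t = C.image r := image_congr fun y hy => htr y hy
    have e2 (u : Fin n) : a (Function.update t x u) = a (Function.update r x u) := ha fun y hy => by
      by_cases hyx : y = x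
      · subst hyx; simp
      · rw [Function.update_of_ne hyx, Function.update_of_ne hyx]
        exact htr y (mem_of_mem_insert_of_ne hy hyx)
    simp only [hφ, e1, e2]
  have h1 := pow_mul_wsum_orderedWeight (X := X) hk (insert x C)
    (dependsOn_mul ha (hdφ.mono_finset (subset_insert x C)))
  rw [h0 φ hdφ, mul_zero] at h1
  have h2 := sum_sum_update x fun t => tupleWeight X (insert x C) t * (a * φ) t
  rw [← h1, mul_zero] at h2
  have h3 (t : ι → Fin n) : ∑ u, tupleWeight X (insert x C) (Function.update t x u) *
      (a * φ) (Function.update t x u) = φ t ^ 2 / (C.card + 1).factorial := by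
    simp only [tupleWeight_update hx, Pi.mul_apply, hdφ.update_of_notMem hx]
    rw [sq, hφ, sum_mul, sum_div]
    exact sum_congr rfl fun u _ => by ring
  simp only [h3] at h2
  have h4 := (sum_eq_zero_iff_of_nonneg fun t _ => by positivity).1 h2 t (mem_univ t)
  have h5 : ((C.card + 1).factorial : ℝ) ≠ 0 := by positivity
  simpa [h5] using h4

lemma IsLSE.abs_wsum_mul_le (h : IsLSE X γ) (hγ : 0 ≤ γ) (hk : Fintype.card ι ≤ d)
    {C : Finset ι} {x y : ι} (hx : x ∉ C) (hy : y ∉ C) (hxy : x ≠ y) {a b : (ι → Fin n) → ℝ}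
    (ha : DependsOn a ((insert x C : Finset ι) : Set ι))
    (hb : DependsOn b ((insert y C : Finset ι) : Set ι))
    (ha0 : ∀ φ, DependsOn φ (C : Set ι) → wsum (orderedWeight X ι) (a * φ) = 0)
    (hb0 : ∀ φ, DependsOn φ (C : Set ι) → wsum (orderedWeight X ι) (b * φ) = 0) :
    |wsum (orderedWeight X ι) (a * b)| ≤
      γ / 2 * (wsum (orderedWeight X ι) (a * a) + wsum (orderedWeight X ι) (b * b)) := by
  rcases isEmpty_or_nonempty (ι → Fin n) with he | he
  · simp [wsum_apply]
  have hyxC : y ∉ insert x C := by simp [hy, hxy.symm]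
  have hxyC : x ∉ insert y C := by simp [hx, hxy]
  have hcard : C.card + 2 ≤ d := by
    have := card_le_univ (insert y (insert x C))
    rw [card_insert_of_notMem hyxC, card_insert_of_notMem hx] at this
    omega
  have hfac : (((C.card + 2).factorial : ℕ) : ℝ) = (C.card + 2) * (C.card + 1).factorial := by
    rw [Nat.factorial_succ]; push_cast; ring
  have hfpos : (0 : ℝ) < (C.card + 1).factorial := by positivity
  have hsq {x : ι} (hx : x ∉ C) {a : (ι → Fin n) → ℝ}
      (ha : DependsOn a ((insert x C : Finset ι) : Set ι)) :
      ∑ t, ((C.card + 2) * ∑ u, X.w (C.card + 1) (insert u (C.image t)) *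
        a (Function.update t x u) ^ 2) / (C.card + 2).factorial =
      (n : ℝ) ^ Cᶜ.card * wsum (orderedWeight X ι) (a * a) := by
    have e1 := sum_sum_update x fun t => tupleWeight X (insert x C) t * (a * a) t
    rw [← pow_mul_wsum_orderedWeight hk _ (dependsOn_mul ha ha), Fintype.card_fin] at e1
    have hCc : Cᶜ.card = (insert x C)ᶜ.card + 1 := by
      have := card_le_univ (insert x C)
      rw [card_compl, card_compl, card_insert_of_notMem hx] at *
      omega
    rw [hCc, pow_succ', mul_assoc, ← e1]
    refine sum_congr rfl fun t _ => ?_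
    simp only [tupleWeight_update hx, Pi.mul_apply]
    rw [hfac, mul_div_mul_left _ _ (by positivity), sum_div]
    exact sum_congr rfl fun u _ => by ring
  have hprod : ∑ t, (∑ u, ∑ v, X.w (C.card + 2) (insert u (insert v (C.image t))) *
      a (Function.update t x u) * b (Function.update t y v)) / (C.card + 2).factorial =
      (n : ℝ) ^ Cᶜ.card * wsum (orderedWeight X ι) (a * b) := by
    set D := insert y (insert x C) with hD
    have hab : DependsOn (a * b) (D : Set ι) :=
      dependsOn_mul (ha.mono_finset (subset_insert _ _))
        (hb.mono_finset (insert_subset_insert _ (subset_insert _ _)))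
    have e1 := sum_sum_update y fun t => tupleWeight X D t * (a * b) t
    have e2 := sum_sum_update x fun t => ∑ v, tupleWeight X D (Function.update t y v) *
      (a * b) (Function.update t y v)
    rw [e1, ← pow_mul_wsum_orderedWeight hk _ hab, Fintype.card_fin] at e2
    have hCc : Cᶜ.card = Dᶜ.card + 1 + 1 := by
      have := card_le_univ D
      rw [card_compl, card_compl, hD, card_insert_of_notMem hyxC, card_insert_of_notMem hx] at *
      omega
    rw [hCc, pow_succ', pow_succ', mul_assoc, mul_assoc, ← e2]
    refine sum_congr rfl fun t _ => ?_
    rw [sum_div]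
    refine sum_congr rfl fun u _ => ?_
    rw [sum_div]
    refine sum_congr rfl fun v _ => ?_
    have e3 : a (Function.update (Function.update t x u) y v) = a (Function.update t x u) :=
      ha.update_of_notMem hyxC _ _
    have e4 : b (Function.update (Function.update t x u) y v) = b (Function.update t y v) := by
      rw [Function.update_comm hxy]
      exact hb.update_of_notMem hxyC _ _
    rw [Pi.mul_apply, e3, e4, hD, tupleWeight_update hyxC, image_update_insert hx,
      card_insert_of_notMem hx, insert_comm v u]
    ring
  have hpos : (0 : ℝ) < (n : ℝ) ^ Cᶜ.card :=
    lt_of_le_of_ne (by positivity) (pow_ne_zero_of_nonempty (n := n) Cᶜ).symm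
  refine le_of_mul_le_mul_left ?_ hpos
  calc _ = |(n : ℝ) ^ Cᶜ.card * wsum (orderedWeight X ι) (a * b)| := by
        rw [abs_mul, abs_of_pos hpos]
    _ ≤ ∑ t, γ / 2 * (((C.card + 2) * ∑ u, X.w (C.card + 1) (insert u (C.image t)) *
        a (Function.update t x u) ^ 2) / (C.card + 2).factorial +
        ((C.card + 2) * ∑ u, X.w (C.card + 1) (insert u (C.image t)) *
        b (Function.update t y u) ^ 2) / (C.card + 2).factorial) := by
        rw [← hprod]
        refine (abs_sum_le_sum_abs _ _).trans (sum_le_sum fun t _ => ?_)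
        have := h.abs_sum_sum_le hγ hcard (s := C.image t) card_image_le
          (sum_w_insert_mul_eq_zero hk hx ha ha0 t) (sum_w_insert_mul_eq_zero hk hy hb hb0 t)
        rw [abs_div, Nat.abs_cast, ← add_div,
          ← mul_div_assoc]
        gcongr
    _ = _ := by
        rw [← mul_sum, sum_add_distrib, hsq hx ha, hsq hy hb]
        ring

lemma IsLSE.abs_wsum_mul_le_wnorm (h : IsLSE X γ) (hγ : 0 ≤ γ) (hk : Fintype.card ι ≤ d)
    {C : Finset ι} {x y : ι} (hx : x ∉ C) (hy : y ∉ C) (hxy : x ≠ y) {a b : (ι → Fin n) → ℝ}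
    (ha : DependsOn a ((insert x C : Finset ι) : Set ι))
    (hb : DependsOn b ((insert y C : Finset ι) : Set ι))
    (ha0 : ∀ φ, DependsOn φ (C : Set ι) → wsum (orderedWeight X ι) (a * φ) = 0)
    (hb0 : ∀ φ, DependsOn φ (C : Set ι) → wsum (orderedWeight X ι) (b * φ) = 0) :
    |wsum (orderedWeight X ι) (a * b)| ≤
      γ * (wnorm (orderedWeight X ι) a * wnorm (orderedWeight X ι) b) := by
  set μ := orderedWeight X ι
  have hμ : 0 ≤ μ := tupleWeight_nonneg univ
  have hCS := _root_.abs_wsum_mul_le hμ a b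
  rcases (wnorm_nonneg μ a).eq_or_lt with hA | hA
  · rw [← hA, zero_mul] at hCS ⊢
    rwa [mul_zero]
  rcases (wnorm_nonneg μ b).eq_or_lt with hB | hB
  · rw [← hB, mul_zero] at hCS ⊢
    rwa [mul_zero]
  have hscale {z : ι} {a : (ι → Fin n) → ℝ} (r : ℝ)
      (ha : DependsOn a ((insert z C : Finset ι) : Set ι)) :
      DependsOn (r • a) ((insert z C : Finset ι) : Set ι) := fun t u htu => by
    simp only [Pi.smul_apply, ha htu]
  have key := h.abs_wsum_mul_le hγ hk hx hy hxy (hscale (wnorm μ b) ha) (hscale (wnorm μ a) hb)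
    (fun φ hφ => by rw [smul_mul_assoc, map_smul, ha0 φ hφ, smul_zero])
    (fun φ hφ => by rw [smul_mul_assoc, map_smul, hb0 φ hφ, smul_zero])
  simp only [smul_mul_smul_comm, map_smul, smul_eq_mul] at key
  rw [← wnorm_mul_self hμ, ← wnorm_mul_self hμ, abs_mul, abs_of_pos (mul_pos hB hA)] at key
  refine le_of_mul_le_mul_left ?_ (mul_pos hB hA)
  refine key.trans_eq ?_
  ring

lemma IsLSE.pairwiseCovLE (h : IsLSE X γ) (hγ : 0 ≤ γ) (hk : Fintype.card ι ≤ d) :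
    PairwiseCovLE (orderedWeight X ι) γ := by
  intro C x y hx hy hxy K H hK hH
  set μ := orderedWeight X ι
  have hμ : 0 ≤ μ := tupleWeight_nonneg univ
  rw [show C ∪ {x} = insert x C by rw [union_comm, insert_eq]] at hK
  rw [show C ∪ {y} = insert y C by rw [union_comm, insert_eq]] at hH
  have horth (K φ : (ι → Fin n) → ℝ) (hφ : DependsOn φ (C : Set ι)) :
      wsum μ ((K - condE μ C K) * φ) = 0 := by
    rw [sub_mul, map_sub, wsum_condE_mul hμ K hφ, sub_self]
  have key := h.abs_wsum_mul_le_wnorm hγ hk hx hy hxy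
    (dependsOn_sub hK ((dependsOn_condE μ C K).mono_finset (subset_insert x C)))
    (dependsOn_sub hH ((dependsOn_condE μ C H).mono_finset (subset_insert y C)))
    (horth K) (horth H)
  have e : wsum μ (K * H) - wsum μ (condE μ C K * condE μ C H) =
      wsum μ ((K - condE μ C K) * (H - condE μ C H)) := by
    have h1 := wsum_condE_mul hμ K (dependsOn_condE μ C H)
    have h2 := wsum_condE_mul hμ H (dependsOn_condE μ C K)
    have h3 : (K - condE μ C K) * (H - condE μ C H) =
        K * H - K * condE μ C H - H * condE μ C K + condE μ C K * condE μ C H := by ring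
    rw [h3, map_add, map_sub, map_sub, ← h1, ← h2, mul_comm (condE μ C H)]
    ring
  rw [e]
  refine key.trans ?_
  have := wnorm_nonneg μ (K - condE μ C K)
  have := wnorm_nonneg μ (H - condE μ C H)
  have := wnorm_nonneg μ K
  gcongr
  · exact wnorm_sub_condE_le hμ C K
  · exact wnorm_sub_condE_le hμ C H

lemma mem_faces_of_orderedWeight_ne_zero {t : ι → Fin n} (ht : orderedWeight X ι t ≠ 0) :
    univ.image t ∈ X.faces (Fintype.card ι) := by
  refine X.mem_faces_of_w_ne_zero fun h => ht ?_
  rw [orderedWeight, tupleWeight, card_univ, h, zero_div]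

lemma injective_of_orderedWeight_ne_zero {t : ι → Fin n} (ht : orderedWeight X ι t ≠ 0) :
    Function.Injective t := by
  have := X.card_mem _ _ (mem_faces_of_orderedWeight_ne_zero ht)
  rw [← card_univ, card_image_iff] at this
  simpa using this

lemma image_mem_faces {t : ι → Fin n} (ht : orderedWeight X ι t ≠ 0) (S : Finset ι) :
    S.image t ∈ X.faces S.card := by
  have := X.mem_faces_of_subset (mem_faces_of_orderedWeight_ne_zero ht)
    (image_subset_image (f := t) (subset_univ S))
  rwa [card_image_of_injective S (injective_of_orderedWeight_ne_zero ht)] at this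

open Classical in
/-- The function on ordered tuples induced by a function on faces, extended by zero. -/
noncomputable def orderedLift (X : WSC n d) (ι : Type*) [Fintype ι] [DecidableEq ι] (f : Cf n) :
    (ι → Fin n) → ℝ := fun t => if orderedWeight X ι t = 0 then 0 else f (univ.image t)

lemma wsum_congr_of_ne_zero {V : Type*} [Fintype V] [DecidableEq V] {μ F G : (ι → V) → ℝ}
    (h : ∀ t, μ t ≠ 0 → F t = G t) : wsum μ F = wsum μ G :=
  sum_congr rfl fun t _ => by
    by_cases ht : μ t = 0
    · simp [ht]
    · rw [h t ht]

lemma orderedLift_of_ne_zero (f : Cf n) {t : ι → Fin n} (ht : orderedWeight X ι t ≠ 0) :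
    orderedLift X ι f t = f (univ.image t) := if_neg ht

lemma condE_orderedLift (hk : Fintype.card ι ≤ d) (f : Cf n) (S : Finset ι) {t : ι → Fin n}
    (ht : orderedWeight X ι t ≠ 0) : condE (orderedWeight X ι) S (orderedLift X ι f) t =
      Dc X (Fintype.card ι) (Fintype.card ι - S.card) f (S.image t) := by
  set μ := orderedWeight X ι
  have hμ : 0 ≤ μ := tupleWeight_nonneg univ
  set D := Dc X (Fintype.card ι) (Fintype.card ι - S.card) f with hD
  set F : (ι → Fin n) → ℝ := fun u => if ∀ i ∈ S, u i = t i then 1 else 0 with hF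
  have hdF : DependsOn F (S : Set ι) := fun u r hur => by
    simp only [hF]
    refine if_congr (forall₂_congr fun i hi => ?_) rfl rfl
    rw [hur i hi]
  have h1 := (WSC.isMartingale_Dc (X := X) hk f).wsum_mul_eq hk S hdF
  simp only [Nat.sub_self, Dc] at h1
  have h2 : wsum μ ((fun u => f (univ.image u)) * F) =
      ∑ u with ∀ i ∈ S, u i = t i, μ u * orderedLift X ι f u := by
    rw [sum_filter, wsum_apply]
    refine sum_congr rfl fun u _ => ?_
    by_cases hu : μ u = 0
    · simp [hu]
    · rw [orderedLift_of_ne_zero f hu]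
      simp [hF]
  have h3 : wsum μ ((fun u => D (S.image u)) * F) =
      D (S.image t) * ∑ u with ∀ i ∈ S, u i = t i, μ u := by
    rw [sum_filter, wsum_apply, mul_sum]
    refine sum_congr rfl fun u _ => ?_
    simp only [hF, Pi.mul_apply]
    split_ifs with hu
    · rw [show S.image u = S.image t from image_congr fun y hy => hu y hy]
      ring
    · simp
  rw [condE_apply, ← h2, h1, h3, mul_div_cancel_right₀ _ (mass_pos_of_ne hμ S ht).ne']

lemma lev_orderedLift (hk : Fintype.card ι ≤ d) (f : Cf n) (S : Finset ι) {t : ι → Fin n}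
    (ht : orderedWeight X ι t ≠ 0) : lev (orderedWeight X ι) ∅ S (orderedLift X ι f) t =
      gLevel X (Fintype.card ι) f S.card (S.image t) := by
  have hinj := injective_of_orderedWeight_ne_zero ht
  rw [WSC.gLevel_apply _ f (image_mem_faces ht S), powerset_image,
    sum_image fun A _ B _ h => image_injective hinj h, lev, Finset.sum_apply]
  refine sum_congr rfl fun R _ => ?_
  rw [Pi.smul_apply, smul_eq_mul, empty_union, condE_orderedLift hk f R ht,
    ← image_sdiff _ _ hinj, card_image_of_injective _ hinj, card_image_of_injective _ hinj]

lemma EE_eq_wsum_orderedLift (hk : Fintype.card ι ≤ d) (f : Cf n) :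
    EE X (Fintype.card ι) f = wsum (orderedWeight X ι) (orderedLift X ι f) := by
  rw [← wsum_image_univ hk]
  exact wsum_congr_of_ne_zero fun t ht => (orderedLift_of_ne_zero f ht).symm

lemma ip_fLevel_eq (hk : Fintype.card ι ≤ d) (f : Cf n) {i : ℕ} (hi : i ≤ Fintype.card ι) :
    ip X (Fintype.card ι) f (fLevel X (Fintype.card ι) f i) =
      ∑ S ∈ powersetCard i univ, wsum (orderedWeight X ι)
        (orderedLift X ι f * lev (orderedWeight X ι) ∅ S (orderedLift X ι f)) := by
  have h1 : ip X (Fintype.card ι) f (fLevel X (Fintype.card ι) f i) =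
      EE X (Fintype.card ι) (f * fLevel X (Fintype.card ι) f i) :=
    sum_congr rfl fun s _ => mul_assoc _ _ _
  rw [h1, ← wsum_image_univ hk, ← map_sum, ← mul_sum]
  refine wsum_congr_of_ne_zero fun t ht => ?_
  have hinj := injective_of_orderedWeight_ne_zero ht
  rw [Pi.mul_apply, Pi.mul_apply, orderedLift_of_ne_zero f ht, Finset.sum_apply,
    WSC.fLevel_apply hi f (mem_faces_of_orderedWeight_ne_zero ht)]
  congr 1
  have : univ.image t = univ.map ⟨t, hinj⟩ := by ext; simp
  rw [this, powersetCard_map, sum_map]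
  refine sum_congr rfl fun S hS => ?_
  rw [lev_orderedLift hk f S ht, (mem_powersetCard.1 hS).2]
  simp [map_eq_image]

lemma condE_le_of_forall_ne_zero {V : Type*} [Fintype V] [DecidableEq V] {μ : (ι → V) → ℝ}
    {S : Finset ι} {F : (ι → V) → ℝ} {c : ℝ} (hc : 0 ≤ c)
    (h : ∀ t, μ t ≠ 0 → condE μ S F t ≤ c) (t : ι → V) : condE μ S F t ≤ c := by
  by_cases hex : ∃ u, (∀ i ∈ S, u i = t i) ∧ μ u ≠ 0
  · obtain ⟨u, hu, hμu⟩ := hex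
    have := dependsOn_condE μ S F (x := u) (y := t) hu
    rw [← this]
    exact h u hμu
  · push Not at hex
    rw [condE_apply, sum_eq_zero fun u hu => hex u (by simpa using hu), div_zero]
    exact hc

lemma normInf_le_one {k : ℕ} {f : Cf n} (hf : IsBool X k f) : normInf X k f ≤ 1 := by
  refine Real.iSup_le (fun τ => ?_) zero_le_one
  rcases hf τ.1 τ.2 with h | h <;> simp [h]

lemma Pseudorandom.condE_le (hk : Fintype.card ι ≤ d) {f : Cf n} {ε : ℝ} {i : ℕ}
    (hf : IsBool X (Fintype.card ι) f) (hε : 0 ≤ ε) (hi : i ≤ Fintype.card ι)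
    (h : Pseudorandom X (Fintype.card ι) ε i f) {S : Finset ι} (hS : S.card ≤ i)
    (t : ι → Fin n) : condE (orderedWeight X ι) S (orderedLift X ι f) t ≤ ε := by
  have hμ : 0 ≤ orderedWeight X ι := tupleWeight_nonneg univ
  obtain ⟨T, hST, hT⟩ := exists_superset_card_eq hS hi
  rw [← condE_condE hμ hST]
  refine _root_.condE_le hμ S hε (condE_le_of_forall_ne_zero hε fun t ht => ?_) t
  have hface := image_mem_faces ht T
  rw [condE_orderedLift hk f T ht, ← WSC.linkMean_eq_Dc hk (hT.trans_le hi) hface]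
  rw [hT] at hface
  exact (le_abs_self _).trans ((h _ hface).1.trans
    (mul_le_of_le_one_right hε (normInf_le_one hf)))

end Tuples

/-- level-`i` inequality: there exist universal constants
`C₁, C₂ > 0` such that on any two-sided `γ`-local-spectral expander with
`γ ≤ 2^{−C₁k}`, any Boolean `(ε,i)`-pseudorandom `f ∈ C_k` satisfies
`⟨f, f_i^↑⟩ ≤ 2^{C₂i}·ε^{1/3}·E[f]`. -/
theorem stmt14 : ∃ C₁ C₂ : ℝ, 0 < C₁ ∧ 0 < C₂ ∧
    ∀ (n d : ℕ) (X : WSC n d) (γ : ℝ), 0 ≤ γ → IsLSE X γ →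
    ∀ (k : ℕ), k ≤ d → γ ≤ (2:ℝ) ^ (-(C₁ * (k:ℝ))) →
    ∀ (f : Cf n), IsBool X k f → ∀ (ε : ℝ), 0 ≤ ε → ∀ (i : ℕ), i ≤ k →
    Pseudorandom X k ε i f →
    ip X k f (fLevel X k f i) ≤ (2:ℝ) ^ (C₂ * (i:ℝ)) * ε ^ ((1:ℝ)/3) * EE X k f := by
  refine ⟨20, 10, by norm_num, by norm_num, ?_⟩
  intro n d X γ hγ hL k hk hγk f hf ε hε i hi hps
  set μ := orderedWeight X (Fin k) with hμdef
  have hμ : 0 ≤ μ := tupleWeight_nonneg univ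
  set F := orderedLift X (Fin k) f with hF
  have hip : ip X k f (fLevel X k f i) = ∑ S ∈ powersetCard i univ, wsum μ (F * lev μ ∅ S F) := by
    have := ip_fLevel_eq (X := X) (ι := Fin k) (by simpa using hk) f (i := i) (by simpa using hi)
    simpa using this
  have hEE : EE X k f = wsum μ F := by
    have := EE_eq_wsum_orderedLift (X := X) (ι := Fin k) (by simpa using hk) f
    simpa using this
  have hF01 (t : Fin k → Fin n) : F t = 0 ∨ F t = 1 := by
    by_cases ht : μ t = 0
    · exact Or.inl (if_pos ht)
    · rw [hF, orderedLift_of_ne_zero f ht]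
      refine hf _ ?_
      simpa using mem_faces_of_orderedWeight_ne_zero ht
  have hF0 : 0 ≤ F := fun t => by rcases hF01 t with h | h <;> simp [h]
  have hF1 : F ≤ 1 := fun t => by rcases hF01 t with h | h <;> simp [h]
  have hFF : F * F = F := funext fun t => by rcases hF01 t with h | h <;> simp [h]
  have hN : 0 ≤ wsum μ F := wsum_nonneg hμ hF0
  have hcond (S : Finset (Fin k)) (hS : S.card ≤ i) (t : Fin k → Fin n) : condE μ S F t ≤ ε :=
    Pseudorandom.condE_le (ι := Fin k) (by simpa using hk) (by simpa using hf) hε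
      (by simpa using hi) (by simpa using hps) hS t
  set e := min (ε ^ ((1 : ℝ) / 3)) 1 with he
  have he0 : 0 ≤ e := le_min (Real.rpow_nonneg hε _) zero_le_one
  have he1 : e ≤ 1 := min_le_right _ _
  have hcond' (S : Finset (Fin k)) (hS : S.card ≤ i) (t : Fin k → Fin n) :
      condE μ S F t ≤ e ^ 3 := by
    rcases min_choice (ε ^ ((1 : ℝ) / 3)) 1 with hm | hm
    · rw [he, hm, ← Real.rpow_natCast, ← Real.rpow_mul hε]
      simpa using hcond S hS t
    · rw [he, hm, one_pow]
      exact (le_abs_self _).trans (abs_condE_le_one hμ hF0 hF1 S t)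
  have hpow : (2 : ℝ) ^ ((10 : ℝ) * (i : ℝ)) = 1024 ^ i := by
    rw [Real.rpow_mul (by norm_num), Real.rpow_natCast]
    norm_num
  rw [hip, hEE, hpow]
  have hfinal : 1024 ^ i * e * wsum μ F ≤ 1024 ^ i * ε ^ ((1 : ℝ) / 3) * wsum μ F := by
    gcongr
    exact min_le_left _ _
  refine le_trans ?_ hfinal
  rcases Nat.eq_zero_or_pos i with rfl | hi1
  · simp only [powersetCard_zero, sum_singleton, pow_zero, one_mul]
    rw [← smul_eq_mul e, ← map_smul]
    refine wsum_mono hμ fun t => ?_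
    have h1 := hcond' ∅ (by simp) t
    have h2 : e ^ 3 ≤ e := pow_le_of_le_one he0 he1 (by norm_num)
    simp only [lev, powerset_empty, sum_singleton, empty_union, Pi.mul_apply, Pi.smul_apply,
      smul_eq_mul, Finset.sdiff_self, card_empty, pow_zero, one_mul]
    rw [mul_comm]
    exact mul_le_mul_of_nonneg_right (h1.trans h2) (hF0 t)
  · have hsmall : (2 ^ 20 : ℝ) ^ k * γ ≤ 1 := by
      have : (2 : ℝ) ^ (-((20 : ℝ) * (k : ℝ))) = ((2 ^ 20) ^ k)⁻¹ := by
        rw [Real.rpow_neg (by norm_num), Real.rpow_mul (by norm_num), Real.rpow_natCast]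
        norm_num
      rw [this] at hγk
      calc (2 ^ 20 : ℝ) ^ k * γ ≤ (2 ^ 20) ^ k * ((2 ^ 20) ^ k)⁻¹ := by gcongr
        _ = 1 := mul_inv_cancel₀ (by positivity)
    exact (hL.pairwiseCovLE hγ (by simpa using hk)).level_inequality hμ hγ
      (by simpa using hsmall) hF0 hF1 hFF hcond' he0 he1 (by simpa using hi) hi1
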